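/- Let Φ⁺ ⊂ ℕ^4 be the set of the following 24 vectors (the positive roots of F_4 in simple-root coordinates, with α_1, α_2 long and α_3, α_4 short): (1,0,0,0), (0,1,0,0), (0,0,1,0), (0,0,0,1), (1,1,0,0), (0,1,1,0), (0,0,1,1), (1,1,1,0), (0,1,1,1), (0,1,2,0), (1,1,1,1), (1,1,2,0), (0,1,2,1), (1,1,2,1), (0,1,2,2), (1,2,2,0), (1,1,2,2), (1,2,2,1), (1,2,2,2), (1,2,3,1), (1,2,3,2), (1,2,4,2), (1,3,4,2), (2,3,4,2). Then in ℤ[[q, y_1, y_2, y_3, y_4]]: ∏_{c ∈ Φ⁺} ∏_{n≥1} (1 − q^n y_1^{c_1} y_2^{c_2} y_3^{c_3} y_4^{c_4})^{−1} = ∑ over all 4-tuples (r_1, r_2, r_3, r_4) of descending sequences of q^{E} · ( ∏_{i=1}^{4} y_i^{|r_i|} ) · ∏_{i=1}^{4} ∏_{j≥1} (q;q)_{r_i^{(j)} − r_i^{(j+1)}}^{−1}, where E = ∑_{i=1}^{4} ∑_{t≥1} (r_i^{(t)})² − ∑_{t≥1} r_1^{(t)} r_2^{(t)} − ∑_{t≥1}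 r_2^{(t)} ( r_3^{(2t−1)} + r_3^{(2t)} ) − ∑_{t≥1} r_3^{(t)} r_4^{(t)}; here E is a nonnegative integer. -/

import Mathlib

open MvPowerSeries

/-- The product topology (coefficientwise convergence) on multivariate formal power series. -/
noncomputable instance (σ R : Type*) [TopologicalSpace R] :
    TopologicalSpace (MvPowerSeries σ R) :=
  inferInstanceAs (TopologicalSpace ((σ →₀ ℕ) → R))

/-- `r : ℕ → ℕ` is a descending sequence (indexed so that `r t = r^{(t+1)}`):
nonincreasing and eventually zero. -/
def IsDescending (r : ℕ → ℕ) : Prop :=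
  Antitone r ∧ ∃ N, ∀ t ≥ N, r t = 0

/-- The 24 positive roots of `F₄` in simple-root coordinates (with `α₁, α₂` long and
`α₃, α₄` short). -/
def posRootsF4 : Finset (Fin 4 → ℕ) :=
  { ![1,0,0,0], ![0,1,0,0], ![0,0,1,0], ![0,0,0,1],
    ![1,1,0,0], ![0,1,1,0], ![0,0,1,1], ![1,1,1,0],
    ![0,1,1,1], ![0,1,2,0], ![1,1,1,1], ![1,1,2,0],
    ![0,1,2,1], ![1,1,2,1], ![0,1,2,2], ![1,2,2,0],
    ![1,1,2,2], ![1,2,2,1], ![1,2,2,2], ![1,2,3,1],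
    ![1,2,3,2], ![1,2,4,2], ![1,3,4,2], ![2,3,4,2] }


namespace PowerSeries

open Finset

variable {K : Type*} [Field K]

/-- The shifted sum `∑ₛ Xˢ * F s`. -/
noncomputable def shiftSum (F : ℕ → K⟦X⟧) : K⟦X⟧ :=
  PowerSeries.mk fun n => ∑ s ∈ range (n + 1), coeff (n - s) (F s)

lemma coeff_shiftSum (F : ℕ → K⟦X⟧) {n N : ℕ} (h : n < N) :
    coeff n (shiftSum F) = coeff n (∑ s ∈ range N, X ^ s * F s) := by
  rw [shiftSum, coeff_mk, map_sum]
  simp only [coeff_X_pow_mul']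
  rw [← sum_filter]
  refine sum_congr ?_ fun _ _ => rfl
  ext s
  simp only [mem_range, mem_filter]
  omega

lemma mul_shiftSum (p : K⟦X⟧) (F : ℕ → K⟦X⟧) :
    p * shiftSum F = shiftSum fun s => p * F s := by
  ext n
  rw [coeff_shiftSum _ n.lt_succ_self, coeff_mul]
  have : (∑ s ∈ range (n + 1), X ^ s * (p * F s)) = p * ∑ s ∈ range (n + 1), X ^ s * F s := by
    rw [mul_sum]; exact sum_congr rfl fun _ _ => by ring
  rw [this, coeff_mul]
  refine sum_congr rfl fun x hx => ?_
  rw [coeff_shiftSum (N := n + 1)]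
  rw [HasAntidiagonal.mem_antidiagonal] at hx
  omega

lemma shiftSum_sub (F G : ℕ → K⟦X⟧) :
    shiftSum F - shiftSum G = shiftSum fun s => F s - G s := by
  ext n
  simp [shiftSum]

lemma rescale_shiftSum (c : K) (F : ℕ → K⟦X⟧) :
    rescale c (shiftSum F) = shiftSum fun s => C (c ^ s) * rescale c (F s) := by
  ext n
  simp only [coeff_rescale, shiftSum, coeff_mk, mul_sum, coeff_C_mul]
  refine sum_congr rfl fun s hs => ?_
  rw [← mul_assoc, ← pow_add, Nat.add_sub_cancel' (by simp at hs; omega)]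

lemma shiftSum_succ {F : ℕ → K⟦X⟧} (h : F 0 = 0) :
    shiftSum F = X * shiftSum fun s => F (s + 1) := by
  ext n
  cases n with
  | zero => simp [shiftSum, h]
  | succ n =>
    rw [coeff_succ_X_mul]
    simp only [shiftSum, coeff_mk]
    rw [sum_range_succ']
    simp [h]

variable (q : K)

/-- The finite `q`-factorial `(q;q)_m`. -/
def qFactorial (m : ℕ) : K := ∏ u ∈ range m, (1 - q ^ (u + 1))

/-- `1 / (q;q)_{m - s}`, read as zero when `s > m`. -/
noncomputable def invQFactorialSub (m s : ℕ) : K := if s ≤ m then (qFactorial q (m - s))⁻¹ else 0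

/-- The series `1 / ((q;q)_m (qX;q)_m)`. -/
noncomputable def durfeeTail : ℕ → K⟦X⟧
  | 0 => 1
  | m + 1 => C (1 - q ^ (m + 1))⁻¹ * (1 - C (q ^ (m + 1)) * X)⁻¹ * durfeeTail m

variable {q}

lemma one_sub_C_mul_X_mul_inv (a : K) : (1 - C a * X : K⟦X⟧) * (1 - C a * X)⁻¹ = 1 :=
  PowerSeries.mul_inv_cancel _ (by simp)

lemma one_sub_C_mul_X_ne_zero (a : K) : (1 - C a * X : K⟦X⟧) ≠ 0 := by
  intro h
  have := one_sub_C_mul_X_mul_inv a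
  simp [h] at this

lemma durfeeTail_succ (hq : ∀ n : ℕ, 1 - q ^ (n + 1) ≠ 0) (m : ℕ) :
    C (1 - q ^ (m + 1)) * (1 - C (q ^ (m + 1)) * X) * durfeeTail q (m + 1) = durfeeTail q m := by
  have h1 : (C (1 - q ^ (m + 1)) * C (1 - q ^ (m + 1))⁻¹ : K⟦X⟧) = 1 := by
    rw [← map_mul, mul_inv_cancel₀ (hq m), map_one]
  calc _ = (C (1 - q ^ (m + 1)) * C (1 - q ^ (m + 1))⁻¹) *
      ((1 - C (q ^ (m + 1)) * X) * (1 - C (q ^ (m + 1)) * X)⁻¹) * durfeeTail q m := by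
        rw [durfeeTail]; ring
    _ = _ := by rw [h1, one_sub_C_mul_X_mul_inv]; ring

lemma rescale_C (c a : K) : rescale c (C a : K⟦X⟧) = C a := by
  ext n
  rw [coeff_rescale, coeff_C]
  split_ifs with h <;> simp [h]

/-- Passing from `X` to `qX` in `durfeeTail`. -/
lemma rescale_durfeeTail (hq : ∀ n : ℕ, 1 - q ^ (n + 1) ≠ 0) (m : ℕ) :
    (1 - C (q ^ (m + 1)) * X) * rescale q (durfeeTail q m) = (1 - C q * X) * durfeeTail q m := by
  induction m with
  | zero => simp [durfeeTail]
  | succ m ih =>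
    have h2 := durfeeTail_succ hq m
    have h1 := congrArg (rescale q) h2
    have e2 : (C (1 - q ^ (m + 1)) : K⟦X⟧) ≠ 0 := by
      rw [Ne, map_eq_zero_iff _ C_injective]; exact hq m
    have e3 := one_sub_C_mul_X_ne_zero (q ^ (m + 1))
    rw [map_mul, map_mul, rescale_C, map_sub (rescale q), map_one, map_mul (rescale q), rescale_C,
      rescale_X] at h1
    apply mul_left_cancel₀ (mul_ne_zero e2 e3)
    rw [← h1, ← h2] at ih
    rw [show q ^ (m + 1 + 1) = q ^ (m + 1) * q by ring, map_mul]
    linear_combination ih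

end PowerSeries

section Descending

open Finset

/-- Prepend an entry to a sequence. -/
def natCons (s : ℕ) (r : ℕ → ℕ) : ℕ → ℕ
  | 0 => s
  | t + 1 => r t

@[simp] lemma natCons_zero (s : ℕ) (r : ℕ → ℕ) : natCons s r 0 = s := rfl

@[simp] lemma natCons_succ (s : ℕ) (r : ℕ → ℕ) (t : ℕ) : natCons s r (t + 1) = r t := rfl

lemma finprod_nat_succ {M : Type*} [CommMonoid M] {f : ℕ → M} {N : ℕ}
    (h : ∀ t ≥ N, f t = 1) : ∏ᶠ t, f t = f 0 * ∏ᶠ t, f (t + 1) := by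
  rw [finprod_eq_prod_of_mulSupport_subset (s := range (N + 1)) f,
    finprod_eq_prod_of_mulSupport_subset (s := range N), prod_range_succ', mul_comm]
  all_goals
    intro t ht
    simp only [coe_range, Set.mem_Iio]
    by_contra h'
    exact ht (h _ (by omega))

lemma finsum_nat_succ {M : Type*} [AddCommMonoid M] {f : ℕ → M} {N : ℕ}
    (h : ∀ t ≥ N, f t = 0) : ∑ᶠ t, f t = f 0 + ∑ᶠ t, f (t + 1) := by
  rw [finsum_eq_sum_of_support_subset (s := range (N + 1)) f,
    finsum_eq_sum_of_support_subset (s := range N), sum_range_succ', add_comm]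
  all_goals
    intro t ht
    simp only [coe_range, Set.mem_Iio]
    by_contra h'
    exact ht (h _ (by omega))

lemma finsum_nat_eq_sum_range {M : Type*} [AddCommMonoid M] {f : ℕ → M} {N : ℕ}
    (h : ∀ t ≥ N, f t = 0) : ∑ᶠ t, f t = ∑ t ∈ range N, f t := by
  refine finsum_eq_sum_of_support_subset _ fun t ht => ?_
  simp only [coe_range, Set.mem_Iio]
  by_contra h'
  exact ht (h _ (by omega))

lemma isDescending_natCons {s : ℕ} {r : ℕ → ℕ} :
    IsDescending (natCons s r) ↔ r 0 ≤ s ∧ IsDescending r := by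
  constructor
  · rintro ⟨h, N, hN⟩
    exact ⟨h (Nat.zero_le 1), fun a b hab => h (Nat.succ_le_succ hab), N,
      fun t ht => hN (t + 1) (by omega)⟩
  · rintro ⟨h0, h, N, hN⟩
    refine ⟨antitone_nat_of_succ_le fun t => ?_, N + 1, fun t ht => ?_⟩
    · cases t with
      | zero => exact h0
      | succ t => exact h (Nat.le_succ t)
    · cases t with
      | zero => omega
      | succ t => exact hN t (by omega)

lemma isDescending_zero : IsDescending (fun _ => 0) :=
  ⟨fun _ _ _ => le_rfl, 0, fun _ _ => rfl⟩

open Classical in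
/-- The finset of descending sequences with sum `n`. -/
noncomputable def descSeq (n : ℕ) : Finset (ℕ → ℕ) :=
  (piAntidiag (range n) n).filter fun r => Antitone r

lemma IsDescending.lt_finsum {r : ℕ → ℕ} (h : IsDescending r) {t : ℕ} (ht : r t ≠ 0) :
    t < ∑ᶠ t, r t := by
  obtain ⟨ha, N, hN⟩ := h
  have htN : t < N := by
    by_contra h'
    exact ht (hN t (by omega))
  rw [finsum_nat_eq_sum_range hN]
  calc t < ∑ _u ∈ range (t + 1), 1 := by simp
    _ ≤ ∑ u ∈ range (t + 1), r u := by
      refine sum_le_sum fun u hu => ?_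
      have := ha (show u ≤ t by simp at hu; omega)
      omega
    _ ≤ ∑ u ∈ range N, r u :=
      sum_le_sum_of_subset (range_subset_range.2 (by omega))

lemma mem_descSeq {n : ℕ} {r : ℕ → ℕ} :
    r ∈ descSeq n ↔ IsDescending r ∧ ∑ᶠ t, r t = n := by
  simp only [descSeq, mem_filter, mem_piAntidiag, mem_range]
  constructor
  · rintro ⟨⟨h1, h2⟩, h3⟩
    have h4 : ∀ t ≥ n, r t = 0 := fun t ht => by
      by_contra h
      have := h2 t h
      omega
    exact ⟨⟨h3, n, h4⟩, by rw [finsum_nat_eq_sum_range h4, h1]⟩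
  · rintro ⟨h, hn⟩
    have h4 : ∀ t, r t ≠ 0 → t < n := fun t ht => hn ▸ h.lt_finsum ht
    refine ⟨⟨?_, h4⟩, h.1⟩
    rw [← finsum_nat_eq_sum_range, hn]
    intro t ht
    by_contra h
    have := h4 t h
    omega

lemma descSeq_zero : descSeq 0 = {fun _ => 0} := by
  ext r
  rw [mem_descSeq, mem_singleton]
  constructor
  · rintro ⟨h, hn⟩
    funext t
    by_contra ht
    have := h.lt_finsum ht
    omega
  · rintro rfl
    exact ⟨isDescending_zero, by simp⟩

lemma sum_descSeq {M : Type*} [AddCommMonoid M] (f : (ℕ → ℕ) → M) (n : ℕ) :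
    ∑ r ∈ descSeq n, f r = ∑ s ∈ range (n + 1), ∑ r ∈ descSeq (n - s),
      if r 0 ≤ s then f (natCons s r) else 0 := by
  simp_rw [← sum_filter]
  rw [sum_sigma']
  have key : ∀ {s : ℕ} {r : ℕ → ℕ}, IsDescending r →
      ∑ᶠ t, natCons s r t = s + ∑ᶠ t, r t := fun {s r} hr => by
    obtain ⟨_, N, hN⟩ := hr
    refine finsum_nat_succ (N := N + 1) fun t ht => ?_
    cases t with
    | zero => omega
    | succ t => exact hN t (by omega)
  have eta : ∀ r : ℕ → ℕ, natCons (r 0) (fun t => r (t + 1)) = r := fun r => by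
    funext t
    cases t <;> rfl
  refine sum_bij' (fun r _ => ⟨r 0, fun t => r (t + 1)⟩) (fun p _ => natCons p.1 p.2)
    ?_ ?_ ?_ ?_ ?_
  · intro r hr
    rw [mem_descSeq, ← eta r, isDescending_natCons] at hr
    obtain ⟨⟨h0, h1⟩, h2⟩ := hr
    rw [key h1] at h2
    simp only [mem_sigma, mem_range, mem_filter, mem_descSeq]
    exact ⟨by omega, ⟨h1, by omega⟩, h0⟩
  · rintro ⟨s, r⟩ hr
    simp only [mem_sigma, mem_range, mem_filter, mem_descSeq] at hr
    rw [mem_descSeq, isDescending_natCons, key hr.2.1.1]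
    have hs : s < n + 1 := hr.1
    have hn : s + ∑ᶠ t, r t = n := by rw [hr.2.1.2]; omega
    exact ⟨⟨hr.2.2, hr.2.1.1⟩, hn⟩
  · intro r _
    exact eta r
  · rintro ⟨s, r⟩ _
    rfl
  · intro r _
    rw [eta]

end Descending

namespace PowerSeries

open Finset

variable {K : Type*} [Field K] (q : K)

/-- The weight `q ^ (∑ rₜ² - ∑ rₜ vₜ) / ∏ₜ (q;q)_{rₜ - rₜ₊₁}`. -/
noncomputable def descWeight (v r : ℕ → ℕ) : K :=
  ∏ᶠ t, q ^ ((r t : ℤ) ^ 2 - r t * v t) * (qFactorial q (r t - r (t + 1)))⁻¹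

/-- The generating series of descending sequences with weight `descWeight q v`, where the largest
entry is weighted additionally by `κ`. -/
noncomputable def descSeries (κ : ℕ → K) (v : ℕ → ℕ) : K⟦X⟧ :=
  PowerSeries.mk fun n => ∑ r ∈ descSeq n, κ (r 0) * descWeight q v r

lemma descWeight_natCons (v : ℕ → ℕ) {s : ℕ} {r : ℕ → ℕ} (hr : IsDescending r) :
    descWeight q v (natCons s r) = q ^ ((s : ℤ) ^ 2 - s * v 0) *
      (qFactorial q (s - r 0))⁻¹ * descWeight q (fun t => v (t + 1)) r := by
  obtain ⟨_, N, hN⟩ := hr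
  rw [descWeight, finprod_nat_succ (N := N + 1)]
  · rfl
  · intro t ht
    cases t with
    | zero => omega
    | succ t => simp [hN t (by omega), hN (t + 1) (by omega), qFactorial]

lemma descSeries_eq_shiftSum (κ : ℕ → K) (v : ℕ → ℕ) :
    descSeries q κ v = shiftSum fun s => C (κ s * q ^ ((s : ℤ) ^ 2 - s * v 0)) *
      descSeries q (invQFactorialSub q s) fun t => v (t + 1) := by
  ext n
  simp only [descSeries, shiftSum, coeff_mk, coeff_C_mul]
  rw [sum_descSeq]
  refine sum_congr rfl fun s _ => ?_
  rw [mul_sum]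
  refine sum_congr rfl fun r hr => ?_
  rw [invQFactorialSub]
  split_ifs
  · rw [descWeight_natCons q v (mem_descSeq.1 hr).1, natCons_zero]
    ring
  · ring

lemma descSeries_zero_left (v : ℕ → ℕ) : descSeries q 0 v = 0 := by
  ext n
  simp [descSeries]

variable {q}

lemma coeff_zero_descSeries (κ : ℕ → K) (v : ℕ → ℕ) : coeff 0 (descSeries q κ v) = κ 0 := by
  simp [descSeries, descSeq_zero, descWeight, qFactorial]

lemma qFactorial_ne_zero (hq : ∀ n : ℕ, 1 - q ^ (n + 1) ≠ 0) (m : ℕ) : qFactorial q m ≠ 0 :=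
  prod_ne_zero_iff.2 fun _ _ => hq _

lemma invQFactorialSub_succ_succ (m s : ℕ) :
    invQFactorialSub q (m + 1) (s + 1) = invQFactorialSub q m s := by
  simp [invQFactorialSub]

lemma invQFactorialSub_zero_succ (s : ℕ) : invQFactorialSub q 0 (s + 1) = 0 := by
  simp [invQFactorialSub]

lemma invQFactorialSub_eq_sub (hq : ∀ n : ℕ, 1 - q ^ (n + 1) ≠ 0) (m s : ℕ) :
    invQFactorialSub q m s =
      invQFactorialSub q (m + 1) s - q ^ (m + 1 - s) * invQFactorialSub q (m + 1) s := by
  rcases lt_trichotomy s (m + 1) with h | rfl | h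
  · obtain ⟨k, rfl⟩ := Nat.exists_eq_add_of_le (show s ≤ m by omega)
    rw [invQFactorialSub, invQFactorialSub, if_pos (by omega), if_pos (by omega),
      show s + k - s = k by omega, show s + k + 1 - s = k + 1 by omega]
    simp only [qFactorial]
    rw [prod_range_succ, mul_inv]
    have := hq k
    field_simp
  · simp [invQFactorialSub]
  · simp [invQFactorialSub, show ¬ s ≤ m by omega, show ¬ s ≤ m + 1 by omega]

/-- The Durfee rectangle identity. -/
lemma durfeeTail_eq_shiftSum (hq : ∀ n : ℕ, 1 - q ^ (n + 1) ≠ 0) (m : ℕ) :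
    durfeeTail q m = shiftSum fun s => C (invQFactorialSub q m s * q ^ (s ^ 2)) *
      durfeeTail q s := by
  induction m with
  | zero =>
    ext n
    rw [shiftSum, coeff_mk, sum_range_succ']
    simp [invQFactorialSub, durfeeTail, qFactorial]
  | succ m ih =>
    have e2 : (C (1 - q ^ (m + 1)) : K⟦X⟧) ≠ 0 := by
      rw [Ne, map_eq_zero_iff _ C_injective]; exact hq m
    have e3 := one_sub_C_mul_X_ne_zero (q ^ (m + 1))
    apply mul_left_cancel₀ (mul_ne_zero e2 e3)
    rw [durfeeTail_succ hq, ih, mul_shiftSum, ← sub_eq_zero, shiftSum_sub]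
    let a : ℕ → K := fun s => q ^ (m + 1 - s) * invQFactorialSub q (m + 1) s
    let G : ℕ → K⟦X⟧ := fun s =>
      C (a s) * C (q ^ (s ^ 2)) * (C (1 - q ^ s) * (1 - C (q ^ s) * X) * durfeeTail q s)
    have hG := shiftSum_succ (F := G) (by simp [G])
    rw [mul_shiftSum, eq_comm, ← sub_eq_zero, shiftSum_sub] at hG
    rw [← hG]
    congr 1
    funext s
    have ha : q ^ s * a s = q ^ (m + 1) * invQFactorialSub q (m + 1) s := by
      by_cases h : s ≤ m + 1
      · simp only [a]
        rw [← mul_assoc, ← pow_add, Nat.add_sub_cancel' h]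
      · simp [a, invQFactorialSub, h]
    have ha' : a (s + 1) * q ^ ((s + 1) ^ 2) =
        q ^ (m + 1) * q ^ s * invQFactorialSub q m s * q ^ (s ^ 2) := by
      simp only [a]
      rw [invQFactorialSub_succ_succ]
      by_cases h : s ≤ m
      · obtain ⟨k, rfl⟩ := Nat.exists_eq_add_of_le h
        rw [show s + k + 1 - (s + 1) = k by omega]
        ring
      · simp [invQFactorialSub, h]
    simp only [G]
    rw [durfeeTail_succ hq s, ← map_mul C (a (s + 1)), ha',
      invQFactorialSub_eq_sub hq m s]
    change C ((_ - a s) * _) * _ - _ = X * (C (_ * (_ - a s) * _) * _) - _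
    have ha2 := congrArg (C : K → K⟦X⟧) ha
    simp only [map_mul, map_sub, map_one] at ha2 ⊢
    linear_combination -(1 + X - X * C (q ^ (m + 1)) - C (q ^ s) * X) * C (q ^ (s ^ 2)) *
      durfeeTail q s * ha2

lemma descSeries_invQFactorialSub_zero (v : ℕ → ℕ) :
    descSeries q (invQFactorialSub q 0) v = 1 := by
  ext n
  cases n with
  | zero =>
    rw [coeff_zero_descSeries]
    simp [invQFactorialSub, qFactorial]
  | succ n =>
    rw [descSeries, coeff_mk, coeff_one, if_neg (Nat.succ_ne_zero n)]
    refine sum_eq_zero fun r hr => ?_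
    rw [mem_descSeq] at hr
    have h0 : r 0 ≠ 0 := fun h0 => by
      have : ∀ t, r t = 0 := fun t => by
        have := hr.1.1 (Nat.zero_le t)
        omega
      simp [this] at hr
    rw [invQFactorialSub, if_neg (by omega), zero_mul]

lemma descSeries_zero (hq : ∀ n : ℕ, 1 - q ^ (n + 1) ≠ 0) (m : ℕ) :
    descSeries q (invQFactorialSub q m) (fun _ => 0) = durfeeTail q m := by
  ext n
  induction n using Nat.strong_induction_on generalizing m with
  | _ n ih =>
    rw [descSeries_eq_shiftSum, durfeeTail_eq_shiftSum hq]
    simp only [shiftSum, coeff_mk, coeff_C_mul]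
    refine sum_congr rfl fun s hs => ?_
    simp only [Nat.cast_zero, mul_zero, sub_zero]
    rw [show q ^ ((s : ℤ) ^ 2) = q ^ (s ^ 2) by rw [← zpow_natCast]; push_cast; rfl]
    congr 1
    cases s with
    | zero => rw [descSeries_invQFactorialSub_zero]; rfl
    | succ s => exact ih _ (by simp at hs; omega) _

/-- Add `1` to the first `a` entries of a sequence. -/
def addOnes (a : ℕ) (v : ℕ → ℕ) : ℕ → ℕ := fun t => if t < a then v t + 1 else v t

lemma addOnes_succ (a : ℕ) (v : ℕ → ℕ) :
    (fun t => addOnes (a + 1) v (t + 1)) = addOnes a fun t => v (t + 1) := by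
  funext t
  simp [addOnes]

lemma descSeries_addOnes_sub_X_mul (hq0 : q ≠ 0) (hq : ∀ n : ℕ, 1 - q ^ (n + 1) ≠ 0) (a : ℕ) :
    ∀ (κ : ℕ → K) (v : ℕ → ℕ), (∀ t > a, v t = 0) →
      descSeries q κ (addOnes (a + 1) v) - X * descSeries q κ (addOnes a v) =
        (1 - X) * rescale q⁻¹ (descSeries q κ v) := by
  induction a with
  | zero =>
    intro κ v hv
    have hv' : (fun t => v (t + 1)) = fun _ => 0 := funext fun t => hv _ (by omega)
    rw [descSeries_eq_shiftSum q κ v, descSeries_eq_shiftSum q κ (addOnes 1 v),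
      descSeries_eq_shiftSum q κ (addOnes 0 v), rescale_shiftSum, mul_shiftSum, mul_shiftSum,
      shiftSum_sub]
    congr 1
    funext s
    have h1 : (fun t => addOnes (0 + 1) v (t + 1)) = fun _ => 0 := by
      rw [addOnes_succ, hv']; funext t; simp [addOnes]
    have h2 : (fun t => addOnes 0 v (t + 1)) = fun _ => 0 := by
      rw [← hv']; funext t; simp [addOnes]
    rw [h1, h2, hv', descSeries_zero hq]
    have e1 : addOnes (0 + 1) v 0 = v 0 + 1 := by simp [addOnes]
    have e2 : addOnes 0 v 0 = v 0 := by simp [addOnes]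
    have h3 := congrArg (rescale q⁻¹) (rescale_durfeeTail hq s)
    rw [map_mul, map_mul, rescale_rescale, mul_inv_cancel₀ hq0, rescale_one, RingHom.id_apply,
      map_sub, map_sub, map_mul, map_mul, rescale_X, map_one, rescale_C, rescale_C, ← mul_assoc,
      ← mul_assoc, ← map_mul, ← map_mul, mul_inv_cancel₀ hq0, map_one, one_mul, pow_succ,
      mul_assoc (q ^ s), mul_inv_cancel₀ hq0, mul_one] at h3
    have e3 : ((s : ℤ) ^ 2 - s * ((v 0 + 1 : ℕ) : ℤ)) = (s : ℤ) ^ 2 - s * v 0 + -(s : ℤ) := by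
      push_cast; ring
    rw [e1, e2, e3, zpow_add₀ hq0, zpow_neg, zpow_natCast, map_mul (rescale q⁻¹), rescale_C,
      inv_pow]
    have e4 : (C (q ^ s)⁻¹ * C (q ^ s) : K⟦X⟧) = 1 := by
      rw [← map_mul, inv_mul_cancel₀ (pow_ne_zero _ hq0), map_one]
    simp only [map_mul]
    linear_combination C (κ s) * C (q ^ ((s : ℤ) ^ 2 - s * v 0)) * C (q ^ s)⁻¹ * h3 + C (κ s) *
      C (q ^ ((s : ℤ) ^ 2 - s * v 0)) * X * durfeeTail q s * e4
  | succ a ih =>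
    intro κ v hv
    rw [descSeries_eq_shiftSum q κ v, descSeries_eq_shiftSum q κ (addOnes (a + 1 + 1) v),
      descSeries_eq_shiftSum q κ (addOnes (a + 1) v), rescale_shiftSum, mul_shiftSum, mul_shiftSum,
      shiftSum_sub]
    congr 1
    funext s
    have h3 := ih (invQFactorialSub q s) (fun t => v (t + 1)) fun t ht => hv _ (by omega)
    rw [addOnes_succ, addOnes_succ]
    have e1 : addOnes (a + 1 + 1) v 0 = v 0 + 1 := by simp [addOnes]
    have e2 : addOnes (a + 1) v 0 = v 0 + 1 := by simp [addOnes]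
    have e3 : ((s : ℤ) ^ 2 - s * ((v 0 + 1 : ℕ) : ℤ)) = (s : ℤ) ^ 2 - s * v 0 + -(s : ℤ) := by
      push_cast; ring
    rw [e1, e2, e3, zpow_add₀ hq0, zpow_neg, zpow_natCast, map_mul (rescale q⁻¹), rescale_C,
      inv_pow]
    simp only [map_mul]
    linear_combination C (κ s) * C (q ^ ((s : ℤ) ^ 2 - s * v 0)) * C (q ^ s)⁻¹ * h3

end PowerSeries

namespace PowerSeries

open Finset

section Euler

variable {R : Type*} [CommRing R]

/-- The coefficients of `(qX;q)_∞`. -/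
noncomputable def eulerCoeff (q : R) (n : ℕ) : R :=
  ∏ j ∈ range n, (-q ^ (j + 1) * Ring.inverse (1 - q ^ (j + 1)))

/-- The series `(qX;q)_∞ = ∏_{n ≥ 1} (1 - qⁿ X)`. -/
noncomputable def eulerSeries (q : R) : R⟦X⟧ := PowerSeries.mk (eulerCoeff q)

lemma eulerSeries_eq {q : R} (hq : ∀ n : ℕ, IsUnit (1 - q ^ (n + 1))) :
    eulerSeries q = (1 - C q * X) * rescale q (eulerSeries q) := by
  ext n
  rw [sub_mul, one_mul, mul_assoc]
  cases n with
  | zero =>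
    rw [map_sub, coeff_C_mul, coeff_zero_X_mul, mul_zero, sub_zero, coeff_rescale, pow_zero,
      one_mul]
  | succ n =>
    simp only [map_sub, coeff_rescale, coeff_C_mul, coeff_succ_X_mul, eulerSeries, coeff_mk]
    rw [eulerCoeff, prod_range_succ, ← eulerCoeff]
    have := Ring.mul_inverse_cancel _ (hq n)
    linear_combination (-q ^ (n + 1) * eulerCoeff q n) * this

end Euler

variable {K : Type*} [Field K] {q : K}

lemma rescale_durfeeTail_eq (hq : ∀ n : ℕ, 1 - q ^ (n + 1) ≠ 0) (s : ℕ) :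
    rescale q (durfeeTail q s) = (1 - C q * X) * (1 - C (q ^ (s + 1))) * durfeeTail q (s + 1) := by
  apply mul_left_cancel₀ (one_sub_C_mul_X_ne_zero (q ^ (s + 1)))
  have h2 := durfeeTail_succ hq s
  rw [map_sub, map_one] at h2
  rw [rescale_durfeeTail hq]
  linear_combination (-(1 - C q * X)) * h2

lemma descSeries_addOnes_sub (hq0 : q ≠ 0) (hq : ∀ n : ℕ, 1 - q ^ (n + 1) ≠ 0) (a : ℕ) :
    ∀ (κ : ℕ → K) (v : ℕ → ℕ), (∀ t > a, v t = 0) →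
      (1 - C q * X) * (descSeries q κ (addOnes (a + 1) v) - descSeries q κ (addOnes a v)) =
        C (q⁻¹ ^ ∑ t ∈ range (a + 1), v t) * X ^ (a + 1) *
          rescale q (descSeries q (fun s => κ (s + 1)) v) := by
  have e3 : ∀ s w : ℕ, q ^ (((s + 1 : ℕ) : ℤ) ^ 2 - (s + 1 : ℕ) * ((w + 1 : ℕ) : ℤ)) =
      q ^ ((s : ℤ) ^ 2 - s * w) * q ^ s * q⁻¹ ^ w := fun s w => by
    rw [← zpow_natCast, ← zpow_natCast, inv_zpow', ← zpow_add₀ hq0, ← zpow_add₀ hq0]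
    congr 1
    push_cast
    ring
  induction a with
  | zero =>
    intro κ v hv
    have hv' : (fun t => v (t + 1)) = fun _ => 0 := funext fun t => hv _ (by omega)
    rw [descSeries_eq_shiftSum q _ v, descSeries_eq_shiftSum q κ (addOnes 1 v),
      descSeries_eq_shiftSum q κ (addOnes 0 v), rescale_shiftSum, shiftSum_sub, mul_shiftSum]
    have h1 : (fun t => addOnes (0 + 1) v (t + 1)) = fun _ => 0 := by
      rw [addOnes_succ, hv']; funext t; simp [addOnes]
    have h2 : (fun t => addOnes 0 v (t + 1)) = fun _ => 0 := by
      rw [← hv']; funext t; simp [addOnes]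
    have e1 : addOnes (0 + 1) v 0 = v 0 + 1 := by simp [addOnes]
    have e2 : addOnes 0 v 0 = v 0 := by simp [addOnes]
    rw [h1, h2, hv', e1, e2, shiftSum_succ (by simp), mul_shiftSum, mul_shiftSum]
    congr 1
    funext s
    have e5 : q ^ (((s + 1 : ℕ) : ℤ) ^ 2 - (s + 1 : ℕ) * (v 0 : ℤ)) =
        q ^ ((s : ℤ) ^ 2 - s * v 0) * q ^ s * q⁻¹ ^ (v 0) * q ^ (s + 1) := by
      rw [← e3, ← zpow_natCast q (s + 1), ← zpow_add₀ hq0]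
      congr 1
      push_cast
      ring
    rw [e3, e5, map_mul (rescale q), rescale_C, descSeries_zero hq, descSeries_zero hq,
      rescale_durfeeTail_eq hq, zero_add, sum_range_one]
    simp only [map_mul]
    ring
  | succ a ih =>
    intro κ v hv
    have e1 : addOnes (a + 1 + 1) v 0 = v 0 + 1 := by simp [addOnes]
    have e2 : addOnes (a + 1) v 0 = v 0 + 1 := by simp [addOnes]
    have h3 : ∀ s, _ := fun s =>
      ih (invQFactorialSub q s) (fun t => v (t + 1)) fun t ht => hv _ (by omega)
    rw [descSeries_eq_shiftSum q _ v, descSeries_eq_shiftSum q κ (addOnes (a + 1 + 1) v),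
      descSeries_eq_shiftSum q κ (addOnes (a + 1) v), rescale_shiftSum, shiftSum_sub, mul_shiftSum,
      addOnes_succ, addOnes_succ, e1, e2]
    have h4 : ∀ s, (1 - C q * X) *
        (C (κ s * q ^ ((s : ℤ) ^ 2 - s * ((v 0 + 1 : ℕ) : ℤ))) *
          descSeries q (invQFactorialSub q s) (addOnes (a + 1) fun t => v (t + 1)) -
        C (κ s * q ^ ((s : ℤ) ^ 2 - s * ((v 0 + 1 : ℕ) : ℤ))) *
          descSeries q (invQFactorialSub q s) (addOnes a fun t => v (t + 1))) =
        C (κ s * q ^ ((s : ℤ) ^ 2 - s * ((v 0 + 1 : ℕ) : ℤ))) *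
        (C (q⁻¹ ^ ∑ t ∈ range (a + 1), v (t + 1)) * X ^ (a + 1) *
          rescale q (descSeries q (fun u => invQFactorialSub q s (u + 1)) fun t => v (t + 1))) :=
      fun s => by rw [← h3 s]; ring
    simp_rw [h4]
    rw [shiftSum_succ, mul_shiftSum, mul_shiftSum]
    · congr 1
      funext s
      simp_rw [invQFactorialSub_succ_succ]
      rw [e3, sum_range_succ' _ (a + 1), pow_add q⁻¹, map_mul (rescale q), rescale_C]
      simp only [map_mul]
      ring
    · simp_rw [invQFactorialSub_zero_succ]
      rw [show (fun _ : ℕ => (0 : K)) = 0 from rfl, descSeries_zero_left]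
      simp

/-- The quotient of the generating series `descSeries q 1 v` by `1 / (qX;q)_∞`. -/
noncomputable def reducedSeries (q : K) (v : ℕ → ℕ) : K⟦X⟧ :=
  eulerSeries q * descSeries q (fun _ => 1) v

lemma reducedSeries_addOnes_sub (hq0 : q ≠ 0) (hq : ∀ n : ℕ, 1 - q ^ (n + 1) ≠ 0) (a : ℕ)
    (v : ℕ → ℕ) (hv : ∀ t > a, v t = 0) :
    reducedSeries q (addOnes (a + 1) v) - reducedSeries q (addOnes a v) =
      C (q⁻¹ ^ ∑ t ∈ range (a + 1), v t) * X ^ (a + 1) * rescale q (reducedSeries q v) := by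
  have h := descSeries_addOnes_sub hq0 hq a (fun _ => 1) v hv
  have he := eulerSeries_eq (q := q) fun n => (hq n).isUnit
  rw [reducedSeries, reducedSeries, reducedSeries, map_mul]
  linear_combination rescale q (eulerSeries q) * h +
    (descSeries q (fun _ => 1) (addOnes (a + 1) v) - descSeries q (fun _ => 1) (addOnes a v)) * he

lemma reducedSeries_addOnes_sub_X_mul (hq0 : q ≠ 0) (hq : ∀ n : ℕ, 1 - q ^ (n + 1) ≠ 0) (a : ℕ)
    (v : ℕ → ℕ) (hv : ∀ t > a, v t = 0) :
    reducedSeries q (addOnes (a + 1) v) - X * reducedSeries q (addOnes a v) =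
      rescale q⁻¹ (reducedSeries q v) := by
  have h := descSeries_addOnes_sub_X_mul hq0 hq a (fun _ => 1) v hv
  have he := congrArg (rescale q⁻¹) (eulerSeries_eq (q := q) fun n => (hq n).isUnit)
  rw [map_mul, map_sub, map_mul, rescale_C, rescale_X, rescale_rescale, mul_inv_cancel₀ hq0,
    rescale_one, RingHom.id_apply, map_one, ← mul_assoc, ← map_mul, mul_inv_cancel₀ hq0, map_one,
    one_mul] at he
  rw [reducedSeries, reducedSeries, reducedSeries, map_mul]
  linear_combination eulerSeries q * h - rescale q⁻¹ (descSeries q (fun _ => 1) v) * he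

lemma reducedSeries_zero (hq : ∀ n : ℕ, 1 - q ^ (n + 1) ≠ 0) :
    reducedSeries q (fun _ => 0) = 1 := by
  have hD : descSeries q (fun _ => (1 : K)) (fun _ => 0) =
      shiftSum fun s => C (q ^ (s ^ 2)) * durfeeTail q s := by
    rw [descSeries_eq_shiftSum]
    congr 1
    funext s
    rw [descSeries_zero hq, one_mul, Nat.cast_zero, mul_zero, sub_zero,
      show q ^ ((s : ℤ) ^ 2) = q ^ (s ^ 2) by rw [← zpow_natCast]; push_cast; rfl]
  have h1 : (1 - C q * X) * descSeries q (fun _ => (1 : K)) (fun _ => 0) =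
      rescale q (descSeries q (fun _ => (1 : K)) (fun _ => 0)) := by
    rw [hD, rescale_shiftSum, mul_shiftSum, ← sub_eq_zero, shiftSum_sub]
    let G : ℕ → K⟦X⟧ := fun s =>
      (1 - C q * X) * (C (q ^ (s ^ 2)) * (1 - C (q ^ s)) * durfeeTail q s)
    have hG := shiftSum_succ (F := G) (by simp [G])
    rw [mul_shiftSum, ← sub_eq_zero, shiftSum_sub] at hG
    rw [← hG]
    congr 1
    funext s
    simp only [G]
    have h2 := durfeeTail_succ hq s
    have h3 := rescale_durfeeTail_eq hq s
    have h4 := rescale_durfeeTail hq s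
    rw [map_mul, rescale_C, show q ^ ((s + 1) ^ 2) = q ^ (s ^ 2) * q ^ s * q ^ (s + 1) by ring]
    simp only [map_mul, map_sub, map_one] at h2 h3 h4 ⊢
    linear_combination C (q ^ (s ^ 2)) * C (q ^ s) * (-h4 - C (q ^ (s + 1)) * X * h3)
  have h2 : reducedSeries q (fun _ => 0) = rescale q (reducedSeries q fun _ => 0) := by
    have he := eulerSeries_eq (q := q) fun n => (hq n).isUnit
    rw [reducedSeries, map_mul]
    linear_combination rescale q (eulerSeries q) * h1 +
      descSeries q (fun _ => (1 : K)) (fun _ => 0) * he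
  ext n
  cases n with
  | zero =>
    have h0 := coeff_zero_descSeries (q := q) (fun _ => (1 : K)) fun _ => 0
    rw [reducedSeries, coeff_mul]
    simp only [Nat.antidiagonal_zero, sum_singleton, h0, eulerSeries, coeff_mk]
    simp [eulerCoeff]
  | succ n =>
    have h3 := congrArg (coeff (n + 1)) h2
    rw [coeff_rescale] at h3
    rw [coeff_one, if_neg n.succ_ne_zero]
    have : (1 - q ^ (n + 1)) * coeff (n + 1) (reducedSeries q fun _ => 0) = 0 := by
      linear_combination h3
    exact (mul_eq_zero.1 this).resolve_left (hq n)

/-- A power series is a palindromic polynomial of (formal) degree `N`. -/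
def IsPalindromic (f : K⟦X⟧) (N : ℕ) : Prop :=
  (∀ i j, i + j = N → coeff i f = coeff j f) ∧ ∀ n > N, coeff n f = 0

lemma isPalindromic_addOnes (hq0 : q ≠ 0) (hq : ∀ n : ℕ, 1 - q ^ (n + 1) ≠ 0) (a N : ℕ)
    (v : ℕ → ℕ) (hv : ∀ t > a, v t = 0) (hN : ∑ t ∈ range (a + 1), v t = N)
    (h0 : IsPalindromic (reducedSeries q v) N)
    (h1 : IsPalindromic (reducedSeries q (addOnes a v)) (N + a)) :
    IsPalindromic (reducedSeries q (addOnes (a + 1) v)) (N + a + 1) := by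
  have r1 := reducedSeries_addOnes_sub hq0 hq a v hv
  have r2 := reducedSeries_addOnes_sub_X_mul hq0 hq a v hv
  rw [hN] at r1
  set F := reducedSeries q (addOnes (a + 1) v)
  set G := reducedSeries q (addOnes a v)
  set H := reducedSeries q v
  have c1 : ∀ n, coeff n F = coeff n G + q⁻¹ ^ N *
      if a + 1 ≤ n then q ^ (n - (a + 1)) * coeff (n - (a + 1)) H else 0 := fun n => by
    have := congrArg (coeff n) r1
    rw [map_sub, mul_assoc, coeff_C_mul, coeff_X_pow_mul', coeff_rescale] at this
    rw [← this]; ring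
  have c2 : coeff 0 F = coeff 0 H := by
    have := congrArg (coeff 0) r2
    rw [map_sub, coeff_zero_X_mul, coeff_rescale] at this
    simpa using this
  have c3 : ∀ n, coeff (n + 1) F = coeff n G + q⁻¹ ^ (n + 1) * coeff (n + 1) H := fun n => by
    have := congrArg (coeff (n + 1)) r2
    rw [map_sub, coeff_succ_X_mul, coeff_rescale] at this
    rw [← this]; ring
  refine ⟨fun i j hij => ?_, fun n hn => ?_⟩
  · cases j with
    | zero =>
      rw [c2, c1, h1.2 i (by omega), if_pos (by omega), show i - (a + 1) = N by omega,
        ← mul_assoc, ← mul_pow, inv_mul_cancel₀ hq0, one_pow, h0.1 N 0 (by omega)]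
      ring
    | succ j =>
      rw [c3, c1, h1.1 i j (by omega)]
      split_ifs with h
      · rw [h0.1 (i - (a + 1)) (j + 1) (by omega), ← mul_assoc,
          show N = (i - (a + 1)) + (j + 1) by omega, pow_add,
          mul_right_comm (q⁻¹ ^ (i - (a + 1))), ← mul_pow, inv_mul_cancel₀ hq0, one_pow, one_mul]
      · rw [h0.2 (j + 1) (by omega)]
        ring
  · rw [c1, h1.2 n (by omega), if_pos (by omega), h0.2 _ (by omega)]
    ring

theorem isPalindromic_reducedSeries (hq0 : q ≠ 0) (hq : ∀ n : ℕ, 1 - q ^ (n + 1) ≠ 0)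
    {v : ℕ → ℕ} (hv : IsDescending v) :
    IsPalindromic (reducedSeries q v) (∑ᶠ t, v t) := by
  generalize hN : ∑ᶠ t, v t = N
  induction N using Nat.strong_induction_on generalizing v with
  | _ N ih =>
    by_cases h0 : v = fun _ => 0
    · subst h0
      rw [reducedSeries_zero hq]
      simp only [finsum_zero] at hN
      subst hN
      refine ⟨fun i j hij => ?_, fun n hn => ?_⟩
      · rw [show i = j by omega]
      · rw [coeff_one, if_neg (by omega)]
    · have hv' := hv
      obtain ⟨ha, M, hM⟩ := hv
      obtain ⟨a, ha0, ha1⟩ : ∃ a, v a ≠ 0 ∧ ∀ t > a, v t = 0 := by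
        classical
        have hex : ∃ n, ∀ t ≥ n, v t = 0 := ⟨M, hM⟩
        have hpos : Nat.find hex ≠ 0 := fun h => by
          have := Nat.find_spec hex
          rw [h] at this
          exact h0 (funext fun t => this t (Nat.zero_le t))
        obtain ⟨a, hfa⟩ := Nat.exists_eq_succ_of_ne_zero hpos
        refine ⟨a, fun h => Nat.find_min hex (m := a) (by omega) fun t ht => ?_, fun t ht => ?_⟩
        · have := ha ht
          omega
        · exact Nat.find_spec hex t (by omega)
      have hpos : ∀ t ≤ a, 1 ≤ v t := fun t ht => by
        have := ha ht
        omega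
      let w : ℕ → ℕ := fun t => v t - 1
      have hw : IsDescending w := ⟨fun s t hst => Nat.sub_le_sub_right (ha hst) 1, M,
        fun t ht => by simp [w, hM t ht]⟩
      have hwa : ∀ t > a, w t = 0 := fun t ht => by simp [w, ha1 t ht]
      have hvw : addOnes (a + 1) w = v := funext fun t => by
        simp only [addOnes, w]
        split_ifs with h
        · have := hpos t (by omega)
          omega
        · have := ha1 t (by omega)
          omega
      have hu : IsDescending (addOnes a w) := by
        refine ⟨antitone_nat_of_succ_le fun t => ?_, max M a, fun t ht => ?_⟩
        · have := hw.1 (Nat.le_succ t)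
          simp only [addOnes, Nat.succ_eq_add_one] at *
          split_ifs <;> omega
        · have : ¬ t < a := by
            have := le_max_right M a
            omega
          simp [addOnes, this, w, hM t (le_trans (le_max_left M a) ht)]
      have sumw : ∑ᶠ t, w t = ∑ t ∈ range (a + 1), w t :=
        finsum_nat_eq_sum_range fun t ht => hwa t (by omega)
      have sumu : ∑ᶠ t, addOnes a w t = ∑ᶠ t, w t + a := by
        rw [sumw, finsum_nat_eq_sum_range (N := a + 1), sum_range_succ, sum_range_succ,
          show addOnes a w a = w a by simp [addOnes],
          sum_congr rfl fun t ht => show addOnes a w t = w t + 1 by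
            simp [addOnes, mem_range.1 ht], sum_add_distrib]
        · simp; ring
        · intro t ht
          simp [addOnes, show ¬ t < a by omega, hwa t (by omega)]
      have sumv : ∑ᶠ t, v t = ∑ᶠ t, w t + a + 1 := by
        rw [sumw, finsum_nat_eq_sum_range (N := a + 1) fun t ht => ha1 t (by omega), ← hvw,
          sum_congr rfl fun t ht => show addOnes (a + 1) w t = w t + 1 by
            simp only [addOnes, mem_range.1 ht, if_true], sum_add_distrib]
        simp; ring
      have key := isPalindromic_addOnes hq0 hq a _ w hwa sumw.symm
        (ih _ (by omega) hw rfl) (ih _ (by omega) hu sumu)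
      rwa [hvw, ← sumv, hN] at key

end PowerSeries

lemma exists_natCast_eq {σ : Type*} {b : σ → ℤ} (h : 0 ≤ b) :
    ∃ β : σ → ℕ, b = fun i => (β i : ℤ) :=
  ⟨fun i => (b i).toNat, funext fun i => (Int.toNat_of_nonneg (h i)).symm⟩

namespace MvPowerSeries

open _root_.Finset

lemma coeff_subst_monomial {σ R : Type*} [CommRing R] (f : PowerSeries R) {c : σ →₀ ℕ}
    (hc : c ≠ 0) (β : σ →₀ ℕ) :
    coeff β (PowerSeries.subst (monomial c (1 : R)) f) =
      ∑ᶠ d : ℕ, PowerSeries.coeff d f * coeff β (monomial (d • c) (1 : R)) := by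
  rw [PowerSeries.coeff_subst (PowerSeries.HasSubst.monomial hc 1)]
  simp only [monomial_pow, one_pow, smul_eq_mul]

section IntCoeff

variable {σ R : Type*} [Fintype σ] [CommRing R]

/-- The exponent attached to a family of natural numbers. -/
noncomputable abbrev expOf (c : σ → ℕ) : σ →₀ ℕ := Finsupp.equivFunOnFinite.symm c

open Classical in
/-- The coefficients of a power series, extended by zero to integral exponents. -/
noncomputable def intCoeff (f : MvPowerSeries σ R) (b : σ → ℤ) : R :=
  if 0 ≤ b then coeff (expOf fun i => (b i).toNat) f else 0

lemma intCoeff_of_not_nonneg (f : MvPowerSeries σ R) {b : σ → ℤ} {i : σ} (h : b i < 0) :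
    intCoeff f b = 0 :=
  if_neg fun h' => absurd (h' i) (not_le.2 h)

lemma intCoeff_natCast (f : MvPowerSeries σ R) (β : σ → ℕ) :
    intCoeff f (fun i => (β i : ℤ)) = coeff (expOf β) f := by
  rw [intCoeff, if_pos (show 0 ≤ fun i => (β i : ℤ) from fun i => Int.natCast_nonneg _)]
  simp

lemma intCoeff_mul (f g : MvPowerSeries σ R) (b : σ → ℤ) :
    intCoeff (f * g) b = ∑ᶠ b', intCoeff f b' * intCoeff g (b - b') := by
  classical
  rw [finsum_eq_sum_of_support_subset (s := Icc 0 b)]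
  · by_cases hb : 0 ≤ b
    · obtain ⟨β, rfl⟩ := exists_natCast_eq hb
      rw [intCoeff_natCast, coeff_mul]
      refine sum_bij' (fun p _ i => (p.1 i : ℤ))
        (fun b' _ => (expOf fun i => (b' i).toNat, expOf fun i => (β i - b' i).toNat))
        ?_ ?_ ?_ ?_ ?_
      · intro p hp
        rw [HasAntidiagonal.mem_antidiagonal] at hp
        refine mem_Icc.2 ⟨fun i => Int.natCast_nonneg _, fun i => ?_⟩
        have := DFunLike.congr_fun hp i
        simp at this
        simp
        omega
      · intro b' hb'
        rw [mem_Icc] at hb'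
        rw [HasAntidiagonal.mem_antidiagonal]
        ext i
        have h1 := hb'.1 i
        have h2 := hb'.2 i
        simp at h1 h2 ⊢
        omega
      · intro p hp
        rw [HasAntidiagonal.mem_antidiagonal] at hp
        ext i
        · simp
        · have := DFunLike.congr_fun hp i
          simp at this ⊢
          omega
      · intro b' hb'
        rw [mem_Icc] at hb'
        funext i
        have h1 := hb'.1 i
        simp at h1 ⊢
        omega
      · intro p hp
        rw [HasAntidiagonal.mem_antidiagonal] at hp
        have h1 : (fun i => (β i : ℤ)) - (fun i => (p.1 i : ℤ)) = fun i => (p.2 i : ℤ) := by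
          funext i
          have := DFunLike.congr_fun hp i
          simp at this ⊢
          omega
        rw [h1, intCoeff_natCast, intCoeff_natCast]
        simp
    · rw [Icc_eq_empty hb, sum_empty, intCoeff, if_neg hb]
  · intro b' hb'
    rw [coe_Icc, Set.mem_Icc]
    rw [Function.mem_support] at hb'
    constructor <;> intro i <;> by_contra h
    · exact hb' (by rw [intCoeff_of_not_nonneg f (i := i) (by simpa using h), zero_mul])
    · exact hb' (by
        rw [intCoeff_of_not_nonneg g (i := i) (by simpa using h), mul_zero])

/-- The series obtained by substituting the monomial with exponent `c` into `f`. -/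
noncomputable def substMonomial (c : σ → ℕ) (f : PowerSeries R) : MvPowerSeries σ R :=
  PowerSeries.subst (monomial (expOf c) (1 : R)) f

lemma intCoeff_substMonomial [DecidableEq (σ → ℤ)] {c : σ → ℕ} (hc : c ≠ 0) (f : PowerSeries R)
    (b : σ → ℤ) :
    intCoeff (substMonomial c f) b =
      ∑ᶠ d : ℕ, PowerSeries.coeff d f * if b = d • (fun i => (c i : ℤ)) then 1 else 0 := by
  classical
  have hc' : expOf c ≠ 0 := fun h => hc (by funext i; simpa using DFunLike.congr_fun h i)
  by_cases hb : 0 ≤ b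
  · obtain ⟨β, rfl⟩ := exists_natCast_eq hb
    rw [intCoeff_natCast, substMonomial, coeff_subst_monomial f hc']
    refine finsum_congr fun d => ?_
    rw [coeff_monomial]
    congr 2
    rw [eq_iff_iff, DFunLike.ext_iff, funext_iff]
    refine forall_congr' fun i => ?_
    simp
    norm_cast
  · rw [intCoeff, if_neg hb, finsum_eq_zero_of_forall_eq_zero]
    intro d
    rw [if_neg, mul_zero]
    rintro rfl
    exact hb fun i => by simp; positivity

/-- If `s` is an additive symmetry of the lattice of exponents then it relates `f` to `g` when
the coefficients of `f` at `s b` are the coefficients of `g` at `b`. -/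
def IntCoeffRel (s : (σ → ℤ) ≃+ (σ → ℤ)) (f g : MvPowerSeries σ R) : Prop :=
  ∀ b, intCoeff f (s b) = intCoeff g b

lemma IntCoeffRel.mul {s : (σ → ℤ) ≃+ (σ → ℤ)} {f g f' g' : MvPowerSeries σ R}
    (h : IntCoeffRel s f g) (h' : IntCoeffRel s f' g') : IntCoeffRel s (f * f') (g * g') := by
  intro b
  rw [intCoeff_mul, intCoeff_mul, ← finsum_comp_equiv s.toEquiv]
  refine finsum_congr fun b' => ?_
  rw [← h, ← h', map_sub]
  rfl

lemma intCoeffRel_substMonomial {s : (σ → ℤ) ≃+ (σ → ℤ)} {c c' : σ → ℕ} (hc : c ≠ 0)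
    (hc' : c' ≠ 0) (h : (fun i => (c i : ℤ)) = s fun i => (c' i : ℤ)) (f : PowerSeries R) :
    IntCoeffRel s (substMonomial c f) (substMonomial c' f) := by
  classical
  intro b
  rw [intCoeff_substMonomial hc, intCoeff_substMonomial hc']
  refine finsum_congr fun d => ?_
  rw [h, ← map_nsmul]
  congr 2
  rw [s.injective.eq_iff]

lemma substMonomial_one {c : σ → ℕ} (hc : c ≠ 0) :
    substMonomial c (1 : PowerSeries R) = 1 := by
  have hc' : expOf c ≠ 0 := fun h => hc (by funext i; simpa using DFunLike.congr_fun h i)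
  rw [substMonomial, ← PowerSeries.coe_substAlgHom (PowerSeries.HasSubst.monomial hc' 1), map_one]

lemma intCoeffRel_one (s : (σ → ℤ) ≃+ (σ → ℤ)) :
    IntCoeffRel s (1 : MvPowerSeries σ R) 1 := by
  classical
  have key : ∀ b : σ → ℤ, intCoeff (1 : MvPowerSeries σ R) b = if b = 0 then 1 else 0 := by
    intro b
    by_cases hb : 0 ≤ b
    · obtain ⟨β, rfl⟩ := exists_natCast_eq hb
      rw [intCoeff_natCast, coeff_one]
      congr 1
      rw [eq_iff_iff, DFunLike.ext_iff, funext_iff]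
      simp
    · rw [intCoeff, if_neg hb, if_neg]
      rintro rfl
      exact hb le_rfl
  intro b
  simp only [key, map_eq_zero_iff s s.injective]

lemma IntCoeffRel.prod {ι : Type*} {s : (σ → ℤ) ≃+ (σ → ℤ)} {f g : ι → MvPowerSeries σ R}
    (t : Finset ι) (h : ∀ i ∈ t, IntCoeffRel s (f i) (g i)) :
    IntCoeffRel s (∏ i ∈ t, f i) (∏ i ∈ t, g i) := by
  classical
  induction t using Finset.induction_on with
  | empty => exact intCoeffRel_one s
  | insert a t ha ih =>
    rw [prod_insert ha, prod_insert ha]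
    exact (h a (mem_insert_self _ _)).mul (ih fun i hi => h i (mem_insert_of_mem hi))

end IntCoeff

end MvPowerSeries

section ExponentF4

open Finset

/-- The quadratic form of the `F₄` fermionic sum, with both long-root sequences indexed by `t` and
the short-root sequences indexed by `2t, 2t + 1`. -/
def localFormF4 (r : Fin 4 → ℕ → ℕ) (t : ℕ) : ℤ :=
  (r 0 t : ℤ) ^ 2 + (r 1 t : ℤ) ^ 2 + ((r 2 (2 * t) : ℤ) ^ 2 + (r 2 (2 * t + 1) : ℤ) ^ 2)
    + ((r 3 (2 * t) : ℤ) ^ 2 + (r 3 (2 * t + 1) : ℤ) ^ 2)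
    - (r 0 t : ℤ) * r 1 t - (r 1 t : ℤ) * ((r 2 (2 * t) : ℤ) + (r 2 (2 * t + 1) : ℤ))
    - ((r 2 (2 * t) : ℤ) * r 3 (2 * t) + (r 2 (2 * t + 1) : ℤ) * r 3 (2 * t + 1))

/-- The exponent of the `F₄` fermionic sum. -/
noncomputable def exponentF4 (r : Fin 4 → ℕ → ℕ) : ℤ :=
  (∑ i : Fin 4, ∑ᶠ t : ℕ, (r i t : ℤ) ^ 2)
    - (∑ᶠ t : ℕ, (r 0 t : ℤ) * (r 1 t : ℤ))
    - (∑ᶠ t : ℕ, (r 1 t : ℤ) * ((r 2 (2 * t) : ℤ) + (r 2 (2 * t + 1) : ℤ)))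
    - ∑ᶠ t : ℕ, (r 2 t : ℤ) * (r 3 t : ℤ)

lemma sum_range_two_mul {M : Type*} [AddCommMonoid M] (f : ℕ → M) (N : ℕ) :
    ∑ s ∈ range (2 * N), f s = ∑ t ∈ range N, (f (2 * t) + f (2 * t + 1)) := by
  induction N with
  | zero => simp
  | succ N ih => rw [mul_add, mul_one, sum_range_succ, sum_range_succ, ih, sum_range_succ, add_assoc]

lemma finsum_nat_eq_sum_even_odd {M : Type*} [AddCommMonoid M] {f : ℕ → M} {N : ℕ}
    (h : ∀ t ≥ N, f t = 0) : ∑ᶠ t, f t = ∑ t ∈ range N, (f (2 * t) + f (2 * t + 1)) := by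
  rw [← sum_range_two_mul, finsum_nat_eq_sum_range (N := 2 * N) fun t ht => h t (by omega)]

lemma exponentF4_eq_sum {r : Fin 4 → ℕ → ℕ} {N : ℕ} (h : ∀ i, ∀ t ≥ N, r i t = 0) :
    exponentF4 r = ∑ t ∈ range N, localFormF4 r t := by
  rw [exponentF4, Fin.sum_univ_four,
    finsum_nat_eq_sum_range (N := N) (f := fun t => (r 0 t : ℤ) ^ 2)
      fun t ht => by simp [h 0 t ht],
    finsum_nat_eq_sum_range (N := N) (f := fun t => (r 1 t : ℤ) ^ 2)
      fun t ht => by simp [h 1 t ht],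
    finsum_nat_eq_sum_even_odd (N := N) (f := fun t => (r 2 t : ℤ) ^ 2)
      fun t ht => by simp [h 2 t ht],
    finsum_nat_eq_sum_even_odd (N := N) (f := fun t => (r 3 t : ℤ) ^ 2)
      fun t ht => by simp [h 3 t ht],
    finsum_nat_eq_sum_range (N := N) (f := fun t => (r 0 t : ℤ) * r 1 t)
      fun t ht => by simp [h 0 t ht],
    finsum_nat_eq_sum_range (N := N)
      (f := fun t => (r 1 t : ℤ) * ((r 2 (2 * t) : ℤ) + (r 2 (2 * t + 1) : ℤ)))
      fun t ht => by simp [h 1 t ht],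
    finsum_nat_eq_sum_even_odd (N := N) (f := fun t => (r 2 t : ℤ) * r 3 t)
      fun t ht => by simp [h 2 t ht]]
  simp only [← sum_add_distrib, ← sum_sub_distrib]
  rfl

lemma exists_common_bound {r : Fin 4 → ℕ → ℕ} (h : ∀ i, IsDescending (r i)) :
    ∃ N, ∀ i, ∀ t ≥ N, r i t = 0 := by
  choose _ N hN using h
  exact ⟨univ.sup N, fun i t ht => hN i t (le_trans (le_sup (mem_univ i)) ht)⟩

lemma localFormF4_nonneg (r : Fin 4 → ℕ → ℕ) (t : ℕ) : 0 ≤ localFormF4 r t := by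
  rw [localFormF4]
  generalize (r 0 t : ℤ) = a
  generalize (r 1 t : ℤ) = b
  generalize (r 2 (2 * t) : ℤ) = c
  generalize (r 2 (2 * t + 1) : ℤ) = c'
  generalize (r 3 (2 * t) : ℤ) = d
  generalize (r 3 (2 * t + 1) : ℤ) = d'
  nlinarith [sq_nonneg (2 * a - b), sq_nonneg (2 * d - c), sq_nonneg (2 * d' - c'),
    sq_nonneg (3 * c - 2 * b), sq_nonneg (3 * c' - 2 * b), sq_nonneg b]

lemma exponentF4_nonneg {r : Fin 4 → ℕ → ℕ} (h : ∀ i, IsDescending (r i)) :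
    0 ≤ exponentF4 r := by
  obtain ⟨N, hN⟩ := exists_common_bound h
  rw [exponentF4_eq_sum hN]
  exact sum_nonneg fun t _ => localFormF4_nonneg r t

/-- The sequence coupled linearly to the `i`-th sequence in the `F₄` quadratic form. -/
def couplingF4 (r : Fin 4 → ℕ → ℕ) : Fin 4 → ℕ → ℕ :=
  ![r 1, fun t => r 0 t + (r 2 (2 * t) + r 2 (2 * t + 1)), fun s => r 1 (s / 2) + r 3 s, r 2]

/-- The sums of the coupled sequences, as a function of the sums of the sequences. -/
def couplingSumF4 {A : Type*} [AddCommMonoid A] (b : Fin 4 → A) : Fin 4 → A :=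
  ![b 1, b 0 + b 2, 2 • b 1 + b 3, b 2]

lemma isDescending_couplingF4 {r : Fin 4 → ℕ → ℕ} (h : ∀ i, IsDescending (r i)) (i : Fin 4) :
    IsDescending (couplingF4 r i) := by
  obtain ⟨N, hN⟩ := exists_common_bound h
  fin_cases i
  · exact h 1
  · refine ⟨fun s t hst => ?_, N, fun t ht => ?_⟩
    · have h1 := (h 0).1 hst
      have h2 := (h 2).1 (show 2 * s ≤ 2 * t by omega)
      have h3 := (h 2).1 (show 2 * s + 1 ≤ 2 * t + 1 by omega)
      simp [couplingF4]
      omega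
    · simp [couplingF4, hN 0 t ht, hN 2 (2 * t) (by omega), hN 2 (2 * t + 1) (by omega)]
  · refine ⟨fun s t hst => ?_, 2 * N, fun t ht => ?_⟩
    · have h1 := (h 1).1 (show s / 2 ≤ t / 2 by omega)
      have h2 := (h 3).1 hst
      simp [couplingF4]
      omega
    · simp [couplingF4, hN 1 (t / 2) (by omega), hN 3 t (by omega)]
  · exact h 2

lemma finsum_couplingF4 {r : Fin 4 → ℕ → ℕ} (h : ∀ i, IsDescending (r i)) (i : Fin 4) :
    ∑ᶠ t, couplingF4 r i t = couplingSumF4 (fun j => ∑ᶠ t, r j t) i := by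
  obtain ⟨N, hN⟩ := exists_common_bound h
  fin_cases i
  · rfl
  · simp only [couplingF4, couplingSumF4, Fin.mk_one, Matrix.cons_val]
    rw [finsum_nat_eq_sum_range (hN 0), finsum_nat_eq_sum_even_odd (hN 2), ← sum_add_distrib]
    exact finsum_nat_eq_sum_range fun t ht => by
      simp [hN 0 t ht, hN 2 (2 * t) (by omega), hN 2 (2 * t + 1) (by omega)]
  · simp only [couplingF4, couplingSumF4, Fin.reduceFinMk, Matrix.cons_val]
    rw [finsum_nat_eq_sum_range (hN 1),
      finsum_nat_eq_sum_range (N := 2 * N) fun t ht => hN 3 t (by omega),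
      finsum_nat_eq_sum_range (N := 2 * N) fun t ht => by
        simp [hN 1 (t / 2) (by omega), hN 3 t (by omega)],
      sum_add_distrib, sum_range_two_mul (fun s => r 1 (s / 2)), smul_sum]
    congr 1
    refine sum_congr rfl fun t _ => ?_
    rw [show 2 * t / 2 = t by omega, show (2 * t + 1) / 2 = t by omega, two_nsmul]
  · rfl

lemma exponentF4_update {r : Fin 4 → ℕ → ℕ} (h : ∀ i, IsDescending (r i)) {i : Fin 4}
    (hi : r i = fun _ => 0) {x : ℕ → ℕ} (hx : IsDescending x) :
    exponentF4 (Function.update r i x) =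
      exponentF4 r + ∑ᶠ t, ((x t : ℤ) ^ 2 - x t * couplingF4 r i t) := by
  obtain ⟨M, hM⟩ := exists_common_bound h
  obtain ⟨_, M', hM'⟩ := hx
  obtain ⟨N, hN, hxN⟩ : ∃ N, (∀ i, ∀ t ≥ N, r i t = 0) ∧ ∀ t ≥ N, x t = 0 :=
    ⟨max M M', fun i t ht => hM i t (le_trans (le_max_left _ _) ht),
      fun t ht => hM' t (le_trans (le_max_right _ _) ht)⟩
  have hu : ∀ j, ∀ t ≥ N, Function.update r i x j t = 0 := fun j t ht => by
    by_cases hj : j = i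
    · subst hj
      simpa using hxN t ht
    · simpa [hj] using hN j t ht
  rw [exponentF4_eq_sum hN, exponentF4_eq_sum hu]
  fin_cases i
  · rw [finsum_nat_eq_sum_range (N := N) fun t ht => by simp [hxN t ht], ← sum_add_distrib]
    refine sum_congr rfl fun t _ => ?_
    simp at hi
    simp [localFormF4, couplingF4, hi]
    ring
  · rw [finsum_nat_eq_sum_range (N := N) fun t ht => by simp [hxN t ht], ← sum_add_distrib]
    refine sum_congr rfl fun t _ => ?_
    simp at hi
    simp [localFormF4, couplingF4, hi]
    ring
  · rw [finsum_nat_eq_sum_even_odd (N := N) fun t ht => by simp [hxN t ht], ← sum_add_distrib]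
    refine sum_congr rfl fun t _ => ?_
    simp at hi
    simp [localFormF4, couplingF4, hi, show (2 * t + 1) / 2 = t by omega]
    ring
  · rw [finsum_nat_eq_sum_even_odd (N := N) fun t ht => by simp [hxN t ht], ← sum_add_distrib]
    refine sum_congr rfl fun t _ => ?_
    simp at hi
    simp [localFormF4, couplingF4, hi]
    ring

end ExponentF4

section FermionicSum

open Finset PowerSeries

variable {K : Type*} [Field K] (q : K)

/-- The coefficient `∏_j 1 / (q;q)_{x_j - x_{j+1}}` attached to a sequence. -/
noncomputable def stepWeight (x : ℕ → ℕ) : K := ∏ᶠ j, (qFactorial q (x j - x (j + 1)))⁻¹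

/-- The summand of the `F₄` fermionic sum. -/
noncomputable def fermionicWeight (r : Fin 4 → ℕ → ℕ) : K :=
  q ^ exponentF4 r * ∏ i, stepWeight q (r i)

/-- The `F₄` fermionic sum as a power series in the `yᵢ`. -/
noncomputable def fermionicSeries : MvPowerSeries (Fin 4) K :=
  fun β => ∑ r ∈ Fintype.piFinset fun i => descSeq (β i), fermionicWeight q r

variable {q}

lemma coeff_fermionicSeries (β : Fin 4 →₀ ℕ) :
    MvPowerSeries.coeff β (fermionicSeries q) =
      ∑ r ∈ Fintype.piFinset fun i => descSeq (β i), fermionicWeight q r := rfl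

lemma zpow_sum₀ {ι : Type*} (hq0 : q ≠ 0) (s : Finset ι) (f : ι → ℤ) :
    q ^ (∑ i ∈ s, f i) = ∏ i ∈ s, q ^ f i := by
  classical
  induction s using Finset.induction_on with
  | empty => simp
  | insert a s ha ih => rw [sum_insert ha, prod_insert ha, zpow_add₀ hq0, ih]

lemma descWeight_eq (hq0 : q ≠ 0) (v : ℕ → ℕ) {x : ℕ → ℕ} (hx : IsDescending x) :
    descWeight q v x = q ^ (∑ᶠ t, ((x t : ℤ) ^ 2 - x t * v t)) * stepWeight q x := by
  obtain ⟨_, N, hN⟩ := hx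
  rw [finsum_nat_eq_sum_range (N := N) fun t ht => by simp [hN t ht], zpow_sum₀ hq0, stepWeight,
    descWeight, finprod_eq_prod_of_mulSupport_subset (s := range N),
    finprod_eq_prod_of_mulSupport_subset (s := range N), prod_mul_distrib]
  all_goals
    intro t ht
    simp only [coe_range, Set.mem_Iio]
    by_contra h
    exact ht (by simp [hN t (by omega), qFactorial])

lemma stepWeight_zero : stepWeight q (fun _ => 0) = 1 := by
  simp [stepWeight, qFactorial]

lemma fermionicWeight_update (hq0 : q ≠ 0) {r : Fin 4 → ℕ → ℕ} (h : ∀ i, IsDescending (r i))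
    {i : Fin 4} (hi : r i = fun _ => 0) {x : ℕ → ℕ} (hx : IsDescending x) :
    fermionicWeight q (Function.update r i x) =
      fermionicWeight q r * descWeight q (couplingF4 r i) x := by
  have h1 : ∏ j, stepWeight q (Function.update r i x j) =
      stepWeight q x * ∏ j, stepWeight q (r j) := by
    rw [← mul_prod_erase _ _ (mem_univ i), ← mul_prod_erase univ (fun j => stepWeight q (r j))
      (mem_univ i), hi, stepWeight_zero, one_mul, Function.update_self]
    congr 1
    refine prod_congr rfl fun j hj => ?_
    rw [Function.update_of_ne (ne_of_mem_erase hj)]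
  rw [fermionicWeight, fermionicWeight, h1, exponentF4_update h hi hx, descWeight_eq hq0 _ hx,
    zpow_add₀ hq0]
  ring

lemma sum_piFinset_update {ι M : Type*} [Fintype ι] [DecidableEq ι] [AddCommMonoid M]
    (F : (ι → ℕ → ℕ) → M) (β : ι → ℕ) (i : ι) (n : ℕ) (hi : β i = 0) :
    ∑ r ∈ Fintype.piFinset fun j => descSeq (Function.update β i n j), F r =
      ∑ r ∈ Fintype.piFinset fun j => descSeq (β j), ∑ x ∈ descSeq n, F (Function.update r i x) := by
  rw [← sum_product']
  refine sum_bij' (fun r _ => (Function.update r i fun _ => 0, r i))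
    (fun p _ => Function.update p.1 i p.2) ?_ ?_ ?_ ?_ ?_
  · intro r hr
    rw [Fintype.mem_piFinset] at hr
    rw [mem_product, Fintype.mem_piFinset]
    refine ⟨fun j => ?_, by simpa using hr i⟩
    by_cases hj : j = i
    · subst hj
      simp [hi, descSeq_zero]
    · simpa [hj] using hr j
  · intro p hp
    rw [mem_product, Fintype.mem_piFinset] at hp
    rw [Fintype.mem_piFinset]
    intro j
    by_cases hj : j = i
    · subst hj
      simpa using hp.2
    · simpa [hj] using hp.1 j
  · intro r _
    simp
  · intro p hp
    rw [mem_product, Fintype.mem_piFinset] at hp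
    have := hp.1 i
    rw [hi, descSeq_zero, mem_singleton] at this
    ext1
    · simp [← this]
    · simp
  · intro r _
    simp

lemma coeff_fermionicSeries_update (hq0 : q ≠ 0) {β : Fin 4 → ℕ} {i : Fin 4} (hi : β i = 0)
    (n : ℕ) :
    MvPowerSeries.coeff (MvPowerSeries.expOf (Function.update β i n)) (fermionicSeries q) =
      ∑ r ∈ Fintype.piFinset fun j => descSeq (β j), fermionicWeight q r *
        PowerSeries.coeff n (descSeries q (fun _ => 1) (couplingF4 r i)) := by
  rw [coeff_fermionicSeries]
  simp only [Finsupp.equivFunOnFinite_symm_apply_apply]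
  rw [sum_piFinset_update _ _ _ _ hi]
  refine sum_congr rfl fun r hr => ?_
  rw [Fintype.mem_piFinset] at hr
  rw [descSeries, coeff_mk, mul_sum]
  refine sum_congr rfl fun x hx => ?_
  rw [one_mul, fermionicWeight_update hq0 (fun j => (mem_descSeq.1 (hr j)).1) _
    (mem_descSeq.1 hx).1]
  simpa [hi, descSeq_zero] using hr i

/-- Multiplication by a series in a single variable, on coefficients. -/
lemma coeff_update_mul_substMonomial {σ R : Type*} [Fintype σ] [DecidableEq σ] [CommRing R]
    (g : MvPowerSeries σ R) (f : R⟦X⟧) {β : σ → ℕ} {i : σ} (hi : β i = 0) (n : ℕ) :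
    MvPowerSeries.coeff (MvPowerSeries.expOf (Function.update β i n))
        (g * MvPowerSeries.substMonomial (Pi.single i 1) f) =
      ∑ p ∈ antidiagonal n, PowerSeries.coeff p.1 f *
        MvPowerSeries.coeff (MvPowerSeries.expOf (Function.update β i p.2)) g := by
  have hc : MvPowerSeries.expOf (Pi.single i 1 : σ → ℕ) ≠ 0 := fun h => by
    simpa using DFunLike.congr_fun h i
  have hd : ∀ d : ℕ, d • MvPowerSeries.expOf (Pi.single i 1 : σ → ℕ) =
      MvPowerSeries.expOf (Pi.single i d) := fun d => by
    ext j
    by_cases hj : j = i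
    · subst hj; simp
    · simp [hj]
  have key : ∀ p ∈ antidiagonal (MvPowerSeries.expOf (Function.update β i n)),
      MvPowerSeries.coeff p.2 (MvPowerSeries.substMonomial (Pi.single i 1) f) =
      ∑ d ∈ range (n + 1), PowerSeries.coeff d f * MvPowerSeries.coeff p.2
        (MvPowerSeries.monomial (MvPowerSeries.expOf (Pi.single i d)) (1 : R)) := by
    intro p hp
    rw [HasAntidiagonal.mem_antidiagonal] at hp
    rw [MvPowerSeries.substMonomial, MvPowerSeries.coeff_subst_monomial f hc]
    simp_rw [hd]
    refine finsum_eq_sum_of_support_subset _ fun d hd' => ?_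
    have h1 : p.2 = MvPowerSeries.expOf (Pi.single i d) := by
      by_contra h
      exact hd' (by simp only [MvPowerSeries.coeff_monomial, if_neg h, mul_zero])
    have h2 := DFunLike.congr_fun hp i
    simp [h1] at h2
    simp
    omega
  rw [MvPowerSeries.coeff_mul, sum_congr rfl fun p hp => by rw [key p hp, mul_sum], sum_comm,
    Nat.sum_antidiagonal_eq_sum_range_succ_mk]
  refine sum_congr rfl fun d hd' => ?_
  have hdn : d ≤ n := by
    rw [mem_range] at hd'
    omega
  rw [sum_congr rfl fun p _ => mul_left_comm _ _ _, ← mul_sum, ← MvPowerSeries.coeff_mul,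
    MvPowerSeries.coeff_mul_monomial, if_pos, mul_one]
  · congr 3
    ext j
    by_cases hj : j = i
    · subst hj; simp
    · simp [hj]
  · intro j
    by_cases hj : j = i
    · subst hj; simpa
    · simp [hj]

lemma coeff_fermionicSeries_mul (hq0 : q ≠ 0) {β : Fin 4 → ℕ} {i : Fin 4} (hi : β i = 0)
    (n : ℕ) :
    MvPowerSeries.coeff (MvPowerSeries.expOf (Function.update β i n))
        (fermionicSeries q * MvPowerSeries.substMonomial (Pi.single i 1) (eulerSeries q)) =
      ∑ r ∈ Fintype.piFinset fun j => descSeq (β j), fermionicWeight q r *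
        PowerSeries.coeff n (reducedSeries q (couplingF4 r i)) := by
  rw [coeff_update_mul_substMonomial _ _ hi]
  simp_rw [coeff_fermionicSeries_update hq0 hi, mul_sum]
  rw [sum_comm]
  refine sum_congr rfl fun r _ => ?_
  rw [reducedSeries, PowerSeries.coeff_mul, mul_sum]
  exact sum_congr rfl fun p _ => mul_left_comm _ _ _

end FermionicSum

section ReflectionF4

open Finset PowerSeries

/-- The simple reflections of `F₄` on the root lattice, in simple-root coordinates. -/
def simpleReflectionF4 (i : Fin 4) : (Fin 4 → ℤ) ≃+ (Fin 4 → ℤ) :=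
  have h : Function.Involutive fun b : Fin 4 → ℤ =>
      Function.update b i (couplingSumF4 b i - b i) := fun b => by
    ext j
    fin_cases i <;> fin_cases j <;> simp [couplingSumF4]
  { h.toPerm with
    map_add' := fun a b => by
      ext j
      fin_cases i <;> fin_cases j <;> simp [couplingSumF4] <;> ring }

lemma simpleReflectionF4_apply (i : Fin 4) (b : Fin 4 → ℤ) :
    simpleReflectionF4 i b = Function.update b i (couplingSumF4 b i - b i) := rfl

lemma couplingSumF4_update {A : Type*} [AddCommMonoid A] (b : Fin 4 → A) (i : Fin 4) (x : A) :
    couplingSumF4 (Function.update b i x) i = couplingSumF4 b i := by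
  fin_cases i <;> simp [couplingSumF4]

lemma couplingSumF4_natCast (β : Fin 4 → ℕ) (i : Fin 4) :
    couplingSumF4 (fun j => (β j : ℤ)) i = (couplingSumF4 β i : ℕ) := by
  fin_cases i <;> simp [couplingSumF4]

/-- The simple reflections on vectors with natural coordinates, truncated. -/
def natReflectionF4 (i : Fin 4) (c : Fin 4 → ℕ) : Fin 4 → ℕ :=
  Function.update c i (couplingSumF4 c i - c i)

lemma natCast_natReflectionF4 {i : Fin 4} {c : Fin 4 → ℕ} (h : c i ≤ couplingSumF4 c i) :
    (fun j => (natReflectionF4 i c j : ℤ)) = simpleReflectionF4 i fun j => (c j : ℤ) := by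
  funext j
  rw [simpleReflectionF4_apply, couplingSumF4_natCast, natReflectionF4]
  by_cases hj : j = i
  · subst hj
    simp [h]
  · simp [hj]

set_option maxRecDepth 10000 in
lemma natReflectionF4_mem : ∀ i : Fin 4, ∀ c ∈ posRootsF4.erase (Pi.single i 1),
    c i ≤ couplingSumF4 c i ∧ natReflectionF4 i c ∈ posRootsF4.erase (Pi.single i 1) ∧
      natReflectionF4 i (natReflectionF4 i c) = c := by
  decide

lemma single_mem_posRootsF4 : ∀ i : Fin 4, Pi.single i 1 ∈ posRootsF4 := by
  decide

lemma ne_zero_of_mem_posRootsF4 {c : Fin 4 → ℕ} (hc : c ∈ posRootsF4) : c ≠ 0 := by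
  rintro rfl
  exact absurd hc (by decide)

variable {K : Type*} [Field K] {q : K}

lemma intCoeffRel_prod_erase (i : Fin 4) (f : K⟦X⟧) :
    IntCoeffRel (simpleReflectionF4 i)
      (∏ c ∈ posRootsF4.erase (Pi.single i 1), substMonomial c f)
      (∏ c ∈ posRootsF4.erase (Pi.single i 1), substMonomial c f) := by
  have h1 : ∏ c ∈ posRootsF4.erase (Pi.single i 1), substMonomial c f =
      ∏ c ∈ posRootsF4.erase (Pi.single i 1), substMonomial (natReflectionF4 i c) f :=
    (prod_bij' (fun c _ => natReflectionF4 i c) (fun c _ => natReflectionF4 i c)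
      (fun c hc => (natReflectionF4_mem i c hc).2.1) (fun c hc => (natReflectionF4_mem i c hc).2.1)
      (fun c hc => (natReflectionF4_mem i c hc).2.2) (fun c hc => (natReflectionF4_mem i c hc).2.2)
      fun c hc => rfl).symm
  nth_rewrite 1 [h1]
  refine IntCoeffRel.prod _ fun c hc => ?_
  obtain ⟨h2, h3, _⟩ := natReflectionF4_mem i c hc
  exact intCoeffRel_substMonomial (ne_zero_of_mem_posRootsF4 (mem_of_mem_erase h3))
    (ne_zero_of_mem_posRootsF4 (mem_of_mem_erase hc)) (natCast_natReflectionF4 h2) f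

lemma intCoeffRel_fermionicSeries_mul (hq0 : q ≠ 0) (hq : ∀ n : ℕ, 1 - q ^ (n + 1) ≠ 0)
    (i : Fin 4) :
    IntCoeffRel (simpleReflectionF4 i)
      (fermionicSeries q * substMonomial (Pi.single i 1) (eulerSeries q))
      (fermionicSeries q * substMonomial (Pi.single i 1) (eulerSeries q)) := by
  intro b
  rw [simpleReflectionF4_apply]
  set F := fermionicSeries q * substMonomial (Pi.single i 1) (eulerSeries q)
  by_cases hb : ∃ j, j ≠ i ∧ b j < 0
  · obtain ⟨j, hji, hj⟩ := hb
    rw [intCoeff_of_not_nonneg F hj,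
      intCoeff_of_not_nonneg F (i := j) (by rwa [Function.update_of_ne hji])]
  · push Not at hb
    obtain ⟨β, hβ⟩ := exists_natCast_eq (b := Function.update b i 0) fun j => by
      by_cases hj : j = i
      · subst hj; simp
      · simpa [hj] using hb j hj
    have hβi : β i = 0 := by simpa using (congrFun hβ i).symm
    have hb' : b = Function.update (fun j => (β j : ℤ)) i (b i) := by
      rw [← hβ, Function.update_idem, Function.update_eq_self]
    have hN : couplingSumF4 b i = (couplingSumF4 β i : ℕ) := by
      rw [hb', couplingSumF4_update, couplingSumF4_natCast]
    have hcast : ∀ n : ℕ, Function.update (fun j => (β j : ℤ)) i n =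
        fun j => ((Function.update β i n j : ℕ) : ℤ) := fun n => by
      funext j
      by_cases hj : j = i
      · subst hj; simp
      · simp [hj]
    have hF : ∀ n : ℕ, intCoeff F (Function.update (fun j => (β j : ℤ)) i n) =
        ∑ r ∈ Fintype.piFinset fun j => descSeq (β j), fermionicWeight q r *
          PowerSeries.coeff n (reducedSeries q (couplingF4 r i)) := fun n => by
      rw [hcast, intCoeff_natCast, coeff_fermionicSeries_mul hq0 hβi]
    have hpal : ∀ r ∈ Fintype.piFinset fun j => descSeq (β j),
        IsPalindromic (reducedSeries q (couplingF4 r i)) (couplingSumF4 β i) := fun r hr => by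
      rw [Fintype.mem_piFinset] at hr
      have hr' : ∀ j, IsDescending (r j) := fun j => (mem_descSeq.1 (hr j)).1
      have := isPalindromic_reducedSeries hq0 hq (isDescending_couplingF4 hr' i)
      rwa [finsum_couplingF4 hr', funext fun j => (mem_descSeq.1 (hr j)).2] at this
    have hneg : ∀ n : ℤ, n < 0 → intCoeff F (Function.update (fun j => (β j : ℤ)) i n) = 0 :=
      fun n hn => intCoeff_of_not_nonneg F (i := i) (by simpa using hn)
    have hbig : ∀ n : ℕ, couplingSumF4 β i < n →
        intCoeff F (Function.update (fun j => (β j : ℤ)) i n) = 0 := fun n hn => by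
      rw [hF]
      exact sum_eq_zero fun r hr => by rw [(hpal r hr).2 n hn, mul_zero]
    rw [hN, hb', Function.update_idem, Function.update_self]
    generalize b i = m
    rcases lt_or_ge m 0 with hm | hm
    · rw [hneg m hm]
      have h := hbig (((couplingSumF4 β i : ℕ) : ℤ) - m).toNat (by omega)
      rwa [Int.toNat_of_nonneg (by omega)] at h
    · obtain ⟨n, rfl⟩ := Int.eq_ofNat_of_zero_le hm
      rcases lt_or_ge (couplingSumF4 β i) n with h | h
      · rw [hneg _ (by omega), hbig n h]
      · rw [← Nat.cast_sub h, hF, hF]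
        exact sum_congr rfl fun r hr => by rw [(hpal r hr).1 _ n (by omega)]

/-- The `F₄` fermionic sum is the inverse of the product of the `(q y^c; q)_∞`. -/
theorem fermionicSeries_mul_prod (hq0 : q ≠ 0) (hq : ∀ n : ℕ, 1 - q ^ (n + 1) ≠ 0) :
    fermionicSeries q * ∏ c ∈ posRootsF4, substMonomial c (eulerSeries q) = 1 := by
  set P := fermionicSeries q * ∏ c ∈ posRootsF4, substMonomial c (eulerSeries q) with hP
  have hs : ∀ i b, intCoeff P (simpleReflectionF4 i b) = intCoeff P b := fun i => by
    rw [hP, ← mul_prod_erase _ _ (single_mem_posRootsF4 i), ← mul_assoc]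
    exact (intCoeffRel_fermionicSeries_mul hq0 hq i).mul (intCoeffRel_prod_erase i _)
  let cox : (Fin 4 → ℤ) → (Fin 4 → ℤ) := fun b =>
    ![b 1 - b 3, b 0 + b 1 - b 3, 2 * b 1 - b 3, b 2 - b 3]
  have hcox : ∀ b, intCoeff P (cox b) = intCoeff P b := fun b => by
    have h : cox b = simpleReflectionF4 0 (simpleReflectionF4 1
        (simpleReflectionF4 2 (simpleReflectionF4 3 b))) := by
      ext j
      fin_cases j <;> simp [cox, simpleReflectionF4_apply, couplingSumF4] <;> ring
    rw [h, hs, hs, hs, hs]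
  have hneg : ∀ b, intCoeff P (-b) = intCoeff P b := fun b => by
    have h : -b = cox (cox (cox (cox (cox (cox b))))) := by
      ext j
      fin_cases j <;> simp [cox] <;> ring
    rw [h, hcox, hcox, hcox, hcox, hcox, hcox]
  ext β
  rw [MvPowerSeries.coeff_one]
  split_ifs with hβ
  · subst hβ
    have h1 : ∀ c ∈ posRootsF4,
        MvPowerSeries.constantCoeff (substMonomial c (eulerSeries q)) = 1 := fun c hc => by
      have hc0 : expOf c ≠ 0 := fun h => ne_zero_of_mem_posRootsF4 hc
        (by funext i; simpa using DFunLike.congr_fun h i)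
      rw [← MvPowerSeries.coeff_zero_eq_constantCoeff_apply, substMonomial,
        coeff_subst_monomial _ hc0, finsum_eq_single _ 0]
      · simp [eulerSeries, eulerCoeff, -PowerSeries.coeff_zero_eq_constantCoeff]
      · intro d hd
        rw [MvPowerSeries.coeff_monomial, if_neg, mul_zero]
        intro h
        exact (smul_ne_zero hd hc0) h.symm
    rw [MvPowerSeries.coeff_zero_eq_constantCoeff_apply, hP, map_mul, map_prod, prod_congr rfl h1,
      prod_const_one, mul_one, ← MvPowerSeries.coeff_zero_eq_constantCoeff_apply,
      coeff_fermionicSeries]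
    simp only [Finsupp.coe_zero, Pi.zero_apply, descSeq_zero, Fintype.piFinset_singleton,
      sum_singleton]
    simp [fermionicWeight, stepWeight_zero, exponentF4]
  · obtain ⟨i, hi⟩ := DFunLike.ne_iff.1 hβ
    have h1 := hneg fun i => (β i : ℤ)
    rw [intCoeff_natCast, intCoeff_of_not_nonneg P (i := i)] at h1
    · simpa [expOf] using h1.symm
    · simpa [Nat.pos_iff_ne_zero] using hi

end ReflectionF4

namespace MvPowerSeries

open _root_.Finset

section HeadVariable

variable {R : Type*} [CommRing R] {m : ℕ}

/-- The coefficients of a power series in `m + 1` variables with respect to the last `m` variables,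
as a power series with coefficients in the power series in the zeroth variable. -/
noncomputable def headCoeff (f : MvPowerSeries (Fin (m + 1)) R) :
    MvPowerSeries (Fin m) (PowerSeries R) :=
  fun β => PowerSeries.mk fun k => coeff (β.cons k) f

lemma coeff_coeff_headCoeff (f : MvPowerSeries (Fin (m + 1)) R) (β : Fin m →₀ ℕ) (k : ℕ) :
    PowerSeries.coeff k (coeff β (headCoeff f)) = coeff (β.cons k) f := by
  change PowerSeries.coeff k (PowerSeries.mk fun k => coeff (β.cons k) f) = _
  rw [PowerSeries.coeff_mk]

lemma headCoeff_mul (f g : MvPowerSeries (Fin (m + 1)) R) :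
    headCoeff (f * g) = headCoeff f * headCoeff g := by
  ext β k
  rw [coeff_mul, map_sum]
  simp_rw [PowerSeries.coeff_mul, coeff_coeff_headCoeff, ← coeff_coeff_finSuccEquiv]
  rw [map_mul, PowerSeries.coeff_mul, map_sum, sum_comm]
  exact sum_congr rfl fun x _ => coeff_mul _ _ _

variable (R m) in
/-- Power series in `m + 1` variables as power series in the last `m` variables whose coefficients
are power series in the zeroth variable. -/
noncomputable def headCoeffEquiv :
    MvPowerSeries (Fin (m + 1)) R ≃+* MvPowerSeries (Fin m) (PowerSeries R) where
  toFun := headCoeff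
  invFun g := fun γ => PowerSeries.coeff (γ 0) (coeff γ.tail g)
  left_inv f := by
    ext γ
    exact (coeff_coeff_headCoeff f γ.tail (γ 0)).trans (by rw [Finsupp.cons_tail])
  right_inv g := by
    ext β k
    refine (coeff_coeff_headCoeff _ β k).trans ?_
    change PowerSeries.coeff ((β.cons k) 0) (coeff (β.cons k).tail g) = _
    rw [Finsupp.cons_zero, Finsupp.tail_cons]
  map_add' f g := by
    ext β k
    simp [coeff_coeff_headCoeff]
  map_mul' := headCoeff_mul

lemma coeff_headCoeffEquiv (f : MvPowerSeries (Fin (m + 1)) R) (β : Fin m →₀ ℕ) :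
    coeff β (headCoeffEquiv R m f) = PowerSeries.mk fun k => coeff (β.cons k) f := rfl

lemma headCoeffEquiv_X_zero : headCoeffEquiv R m (X 0) = C PowerSeries.X := by
  ext β k
  rw [coeff_headCoeffEquiv, PowerSeries.coeff_mk, ← coeff_coeff_finSuccEquiv, finSuccEquiv_X_zero,
    PowerSeries.coeff_X, coeff_C]
  by_cases h1 : k = 1 <;> by_cases h2 : β = 0 <;> simp [h1, h2, coeff_one, PowerSeries.coeff_X]

lemma headCoeffEquiv_X_succ (i : Fin m) : headCoeffEquiv R m (X i.succ) = X i := by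
  ext β k
  rw [coeff_headCoeffEquiv, PowerSeries.coeff_mk, ← coeff_coeff_finSuccEquiv, finSuccEquiv_X_succ,
    PowerSeries.coeff_C, coeff_X]
  by_cases h1 : k = 0 <;> by_cases h2 : β = Finsupp.single i 1 <;>
    simp [h1, h2, PowerSeries.coeff_one, coeff_X]

end HeadVariable

section SubstMonomial

variable {σ R : Type*} [Fintype σ] [CommRing R]

lemma expOf_ne_zero {c : σ → ℕ} (hc : c ≠ 0) : expOf c ≠ 0 :=
  fun h => hc (by funext i; simpa using DFunLike.congr_fun h i)

lemma substMonomial_eq_substAlgHom {c : σ → ℕ} (hc : c ≠ 0) (f : PowerSeries R) :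
    substMonomial c f =
      PowerSeries.substAlgHom (R := R) (PowerSeries.HasSubst.monomial (expOf_ne_zero hc) (1 : R)) f := by
  rw [PowerSeries.coe_substAlgHom, substMonomial]

lemma substMonomial_mul {c : σ → ℕ} (hc : c ≠ 0) (f g : PowerSeries R) :
    substMonomial c (f * g) = substMonomial c f * substMonomial c g := by
  simp only [substMonomial_eq_substAlgHom hc, map_mul]

lemma substMonomial_add {c : σ → ℕ} (hc : c ≠ 0) (f g : PowerSeries R) :
    substMonomial c (f + g) = substMonomial c f + substMonomial c g := by
  simp only [substMonomial_eq_substAlgHom hc, map_add]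

lemma substMonomial_C {c : σ → ℕ} (hc : c ≠ 0) (a : R) :
    substMonomial c (PowerSeries.C a) = C a := by
  rw [substMonomial_eq_substAlgHom hc, ← PowerSeries.algebraMap_eq, AlgHom.commutes]
  rfl

lemma substMonomial_X {c : σ → ℕ} (hc : c ≠ 0) :
    substMonomial c (PowerSeries.X : PowerSeries R) = monomial (expOf c) 1 :=
  PowerSeries.subst_X (PowerSeries.HasSubst.monomial (expOf_ne_zero hc) (1 : R))

lemma map_substMonomial {S : Type*} [CommRing S] (h : R →+* S) {c : σ → ℕ} (hc : c ≠ 0)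
    (f : PowerSeries R) :
    map h (substMonomial c f) = substMonomial c (PowerSeries.map h f) := by
  rw [substMonomial, PowerSeries.map_subst (PowerSeries.HasSubst.monomial (expOf_ne_zero hc) 1),
    map_monomial, map_one, substMonomial]

lemma prod_X_pow_eq_monomial (c : σ → ℕ) : ∏ i, (X i : MvPowerSeries σ R) ^ c i =
    monomial (expOf c) 1 := by
  rw [monomial_eq', map_one, one_mul, Finsupp.prod_fintype _ _ fun i => pow_zero _]
  rfl

end SubstMonomial

end MvPowerSeries

lemma map_ring_inverse {A B : Type*} [CommRing A] [CommRing B] (h : A →+* B) {a : A}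
    (ha : IsUnit a) : h (Ring.inverse a) = Ring.inverse (h a) := by
  have h1 : h (Ring.inverse a) * h a = 1 := by
    rw [← map_mul, Ring.inverse_mul_cancel _ ha, map_one]
  calc h (Ring.inverse a) = h (Ring.inverse a) * (h a * Ring.inverse (h a)) := by
        rw [Ring.mul_inverse_cancel _ (ha.map h), mul_one]
    _ = Ring.inverse (h a) := by rw [← mul_assoc, h1, one_mul]

namespace PowerSeries

open Finset

variable {R : Type*} [CommRing R]

lemma map_eulerSeries {S : Type*} [CommRing S] (h : R →+* S) {q : R}
    (hq : ∀ n : ℕ, IsUnit (1 - q ^ (n + 1))) :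
    map h (eulerSeries q) = eulerSeries (h q) := by
  ext n
  simp only [coeff_map, eulerSeries, coeff_mk, eulerCoeff, map_prod, map_mul, map_neg, map_pow]
  refine prod_congr rfl fun j _ => ?_
  rw [map_ring_inverse h (hq j), map_sub, map_one, map_pow]

lemma eulerSeries_eq_prod_mul {q : R} (hq : ∀ n : ℕ, IsUnit (1 - q ^ (n + 1))) (N : ℕ) :
    eulerSeries q = (∏ n ∈ range N, (1 - C (q ^ (n + 1)) * X)) *
      rescale (q ^ N) (eulerSeries q) := by
  induction N with
  | zero => simp [rescale_one]
  | succ N ih =>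
    have h := congrArg (rescale (q ^ N)) (eulerSeries_eq hq)
    have h2 : rescale (q ^ N) (C q : R⟦X⟧) = C q := by
      ext n
      rw [coeff_rescale, coeff_C]
      split_ifs with h <;> simp [h]
    rw [map_mul, map_sub, map_mul, h2, rescale_X, rescale_rescale, map_one, ← mul_assoc,
      ← map_mul, ← pow_succ'] at h
    rw [prod_range_succ, pow_succ', mul_assoc, ← pow_succ', ← h]
    exact ih

lemma exists_rescale_eulerSeries_eq (q a : R) :
    ∃ g : R⟦X⟧, rescale a (eulerSeries q) = 1 + C a * g := by
  refine ⟨mk fun n => if n = 0 then 0 else a ^ (n - 1) * eulerCoeff q n, ?_⟩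
  ext n
  rw [coeff_rescale, map_add, coeff_C_mul, coeff_mk, coeff_one, eulerSeries, coeff_mk]
  cases n with
  | zero => simp [eulerCoeff]
  | succ n => simp [pow_succ']; ring

lemma isUnit_one_sub_X_pow (n : ℕ) : IsUnit (1 - (X : R⟦X⟧) ^ (n + 1)) := by
  rw [isUnit_iff_constantCoeff]
  simp

end PowerSeries

namespace MvPowerSeries

open _root_.Finset

section EulerProduct

variable {σ R : Type*} [CommRing R]

lemma isUnit_of_X_dvd_one_sub {s : σ} {f : MvPowerSeries σ R} (h : X s ∣ 1 - f) : IsUnit f := by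
  rw [isUnit_iff_constantCoeff]
  obtain ⟨g, hg⟩ := h
  have := congrArg constantCoeff hg
  rw [map_sub, map_one, map_mul, constantCoeff_X, zero_mul, sub_eq_zero] at this
  rw [← this]
  exact isUnit_one

lemma X_pow_dvd_prod_inverse_sub {s : σ} {f : ℕ → MvPowerSeries σ R} {e : MvPowerSeries σ R}
    (hf : ∀ n, X s ^ (n + 1) ∣ 1 - f n) (he : ∀ N, X s ^ N ∣ e - ∏ n ∈ range N, f n)
    (heu : IsUnit e) {N : ℕ} {t : Finset ℕ} (ht : range N ⊆ t) :
    X s ^ N ∣ ∏ n ∈ t, Ring.inverse (f n) - Ring.inverse e := by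
  have hfu : ∀ n, IsUnit (f n) := fun n =>
    isUnit_of_X_dvd_one_sub (dvd_trans (dvd_pow_self _ n.succ_ne_zero) (hf n))
  set π := Ideal.Quotient.mk (Ideal.span {(X s : MvPowerSeries σ R) ^ N}) with hπ
  rw [← Ideal.Quotient.eq_zero_iff_dvd, ← hπ, map_sub, sub_eq_zero]
  have h1 : π e = π (∏ n ∈ t, f n) := by
    have h2 : π e = π (∏ n ∈ range N, f n) := by
      rw [← sub_eq_zero, ← map_sub, hπ, Ideal.Quotient.eq_zero_iff_dvd]
      exact he N
    rw [h2, map_prod, map_prod]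
    refine prod_subset ht fun n _ hn => ?_
    rw [mem_range, not_lt] at hn
    rw [eq_comm, ← sub_eq_zero, ← map_one π, ← map_sub, hπ, Ideal.Quotient.eq_zero_iff_dvd]
    exact dvd_trans (pow_dvd_pow _ (by omega)) (hf n)
  have h2 : π (∏ n ∈ t, Ring.inverse (f n)) * π e = 1 := by
    rw [h1, ← map_mul, ← prod_mul_distrib,
      prod_eq_one fun n _ => Ring.inverse_mul_cancel _ (hfu n), map_one]
  calc π (∏ n ∈ t, Ring.inverse (f n))
      = π (∏ n ∈ t, Ring.inverse (f n)) * (π e * π (Ring.inverse e)) := by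
        rw [← map_mul π e, Ring.mul_inverse_cancel _ heu, map_one, mul_one]
    _ = π (Ring.inverse e) := by rw [← mul_assoc, h2, one_mul]

lemma hasProd_inverse [TopologicalSpace R] {s : σ} {f : ℕ → MvPowerSeries σ R}
    {e : MvPowerSeries σ R} (hf : ∀ n, X s ^ (n + 1) ∣ 1 - f n)
    (he : ∀ N, X s ^ N ∣ e - ∏ n ∈ range N, f n) (heu : IsUnit e) :
    HasProd (fun n => Ring.inverse (f n)) (Ring.inverse e) := by
  refine (tendsto_pi_nhds (A := fun _ : σ →₀ ℕ => R)).2 fun γ => ?_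
  refine tendsto_const_nhds.congr' ?_
  rw [SummationFilter.unconditional_filter]
  filter_upwards [Filter.eventually_ge_atTop (range (γ s + 1))] with t ht
  have := X_pow_dvd_iff.1 (X_pow_dvd_prod_inverse_sub hf he heu ht) γ (Nat.lt_succ_self _)
  rw [map_sub, sub_eq_zero] at this
  exact this.symm

variable {m : ℕ} {c : Fin m → ℕ}

/-- The series `∏_{n ≥ 1} (1 - X₀ⁿ y^c)`. -/
noncomputable def eulerMonomial (c : Fin m → ℕ) : MvPowerSeries (Fin (m + 1)) ℤ :=
  (headCoeffEquiv ℤ m).symm (substMonomial c (PowerSeries.eulerSeries PowerSeries.X))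

lemma X_pow_dvd_eulerMonomial_sub (hc : c ≠ 0) (N : ℕ) :
    (X 0 : MvPowerSeries (Fin (m + 1)) ℤ) ^ N ∣ eulerMonomial c -
      ∏ n ∈ range N, (1 - X 0 ^ (n + 1) * ∏ i : Fin m, X i.succ ^ c i) := by
  have h1 := PowerSeries.eulerSeries_eq_prod_mul
    (q := (PowerSeries.X : PowerSeries ℤ)) PowerSeries.isUnit_one_sub_X_pow N
  obtain ⟨g, hg⟩ := PowerSeries.exists_rescale_eulerSeries_eq
    (PowerSeries.X : PowerSeries ℤ) (PowerSeries.X ^ N)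
  have h2 : substMonomial c (∏ n ∈ range N, (1 - PowerSeries.C ((PowerSeries.X : PowerSeries ℤ) ^
      (n + 1)) * PowerSeries.X)) = headCoeffEquiv ℤ m
      (∏ n ∈ range N, (1 - X 0 ^ (n + 1) * ∏ i : Fin m, X i.succ ^ c i)) := by
    rw [substMonomial_eq_substAlgHom hc, map_prod, map_prod]
    refine prod_congr rfl fun n _ => ?_
    rw [map_sub, map_mul, ← substMonomial_eq_substAlgHom hc, ← substMonomial_eq_substAlgHom hc,
      ← substMonomial_eq_substAlgHom hc, substMonomial_one hc, substMonomial_C hc, substMonomial_X hc,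
      map_sub (headCoeffEquiv ℤ m), map_one (headCoeffEquiv ℤ m), map_mul (headCoeffEquiv ℤ m),
      map_pow (headCoeffEquiv ℤ m), map_prod (headCoeffEquiv ℤ m), headCoeffEquiv_X_zero,
      ← prod_X_pow_eq_monomial, map_pow]
    simp_rw [map_pow, headCoeffEquiv_X_succ]
  have h3 : headCoeffEquiv ℤ m (eulerMonomial c -
      ∏ n ∈ range N, (1 - X 0 ^ (n + 1) * ∏ i : Fin m, X i.succ ^ c i)) =
      headCoeffEquiv ℤ m (X 0 ^ N) * (headCoeffEquiv ℤ m
        (∏ n ∈ range N, (1 - X 0 ^ (n + 1) * ∏ i : Fin m, X i.succ ^ c i)) *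
        substMonomial c g) := by
    rw [map_sub, eulerMonomial, RingEquiv.apply_symm_apply, h1, hg, substMonomial_mul hc, h2,
      substMonomial_add hc, substMonomial_one hc, substMonomial_mul hc, substMonomial_C hc,
      map_pow (headCoeffEquiv ℤ m), headCoeffEquiv_X_zero, map_pow]
    ring
  rw [← map_dvd_iff (headCoeffEquiv ℤ m), h3]
  exact dvd_mul_right _ _

lemma isUnit_eulerMonomial (hc : c ≠ 0) : IsUnit (eulerMonomial c) := by
  refine isUnit_of_X_dvd_one_sub (s := 0) ?_
  have h := X_pow_dvd_eulerMonomial_sub hc 1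
  rw [pow_one, prod_range_one, zero_add, pow_one] at h
  rw [← dvd_neg]
  convert dvd_sub h (dvd_mul_right (X 0) (∏ i : Fin m, (X i.succ : MvPowerSeries _ ℤ) ^ c i)) using 1
  ring

lemma tprod_inverse_one_sub (hc : c ≠ 0) :
    ∏' n : ℕ, Ring.inverse (1 - (X 0 : MvPowerSeries (Fin (m + 1)) ℤ) ^ (n + 1) *
      ∏ i : Fin m, X i.succ ^ c i) = Ring.inverse (eulerMonomial c) := by
  have : T2Space (MvPowerSeries (Fin (m + 1)) ℤ) :=
    inferInstanceAs (T2Space ((Fin (m + 1) →₀ ℕ) → ℤ))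
  refine (hasProd_inverse (s := 0) (fun n => ?_) (X_pow_dvd_eulerMonomial_sub hc)
    (isUnit_eulerMonomial hc)).tprod_eq
  rw [sub_sub_cancel]
  exact dvd_mul_right _ _

end EulerProduct

section FractionField

variable (m : ℕ)

/-- The field of fractions of the ring of power series in `q`. -/
abbrev QField : Type := FractionRing (PowerSeries ℤ)

/-- The element `q`. -/
noncomputable def qElem : QField := algebraMap (PowerSeries ℤ) QField PowerSeries.X

/-- Power series in `q, y₁, …, y_m` as power series in the `yᵢ` over a field containing `q`. -/
noncomputable def headFracHom : MvPowerSeries (Fin (m + 1)) ℤ →+* MvPowerSeries (Fin m) QField :=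
  (map (algebraMap (PowerSeries ℤ) QField)).comp (headCoeffEquiv ℤ m : _ →+* _)

variable {m}

lemma coeff_headFracHom (f : MvPowerSeries (Fin (m + 1)) ℤ) (β : Fin m →₀ ℕ) :
    coeff β (headFracHom m f) =
      algebraMap (PowerSeries ℤ) QField (PowerSeries.mk fun k => coeff (β.cons k) f) := rfl

lemma headFracHom_injective : Function.Injective (headFracHom m) := by
  intro f g h
  refine (headCoeffEquiv ℤ m).injective ?_
  ext1 β
  refine IsFractionRing.injective (PowerSeries ℤ) QField ?_
  exact congrArg (coeff β) h

lemma headFracHom_X_zero : headFracHom m (X 0) = C qElem := by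
  change map (algebraMap (PowerSeries ℤ) QField) (headCoeffEquiv ℤ m (X 0)) = _
  rw [headCoeffEquiv_X_zero, map_C]
  rfl

lemma headFracHom_X_succ (i : Fin m) : headFracHom m (X i.succ) = X i := by
  change map (algebraMap (PowerSeries ℤ) QField) (headCoeffEquiv ℤ m (X i.succ)) = _
  rw [headCoeffEquiv_X_succ, map_X]

lemma headFracHom_eulerMonomial {c : Fin m → ℕ} (hc : c ≠ 0) :
    headFracHom m (eulerMonomial c) = substMonomial c (PowerSeries.eulerSeries qElem) := by
  change map (algebraMap (PowerSeries ℤ) QField) (headCoeffEquiv ℤ m (eulerMonomial c)) = _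
  rw [eulerMonomial, RingEquiv.apply_symm_apply, map_substMonomial _ hc,
    PowerSeries.map_eulerSeries _ PowerSeries.isUnit_one_sub_X_pow]
  rfl

lemma qElem_ne_zero : qElem ≠ 0 := by
  rw [qElem, map_ne_zero_iff _ (IsFractionRing.injective (PowerSeries ℤ) QField)]
  exact PowerSeries.X_ne_zero

lemma one_sub_qElem_pow_ne_zero (n : ℕ) : 1 - qElem ^ (n + 1) ≠ 0 := by
  rw [qElem, ← map_pow, ← map_one (algebraMap (PowerSeries ℤ) QField), ← map_sub]
  exact ((PowerSeries.isUnit_one_sub_X_pow n).map _).ne_zero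

end FractionField

end MvPowerSeries

section Main

open Finset PowerSeries

/-- The summand of the `F₄` fermionic sum in `ℤ[[q, y₁, y₂, y₃, y₄]]`. -/
noncomputable def fermionicTerm (r : Fin 4 → ℕ → ℕ) : MvPowerSeries (Fin 5) ℤ :=
  (MvPowerSeries.X 0) ^ (exponentF4 r).toNat
    * (∏ i : Fin 4, (MvPowerSeries.X i.succ) ^ (∑ᶠ t : ℕ, r i t))
    * ∏ i : Fin 4, ∏ᶠ j : ℕ, Ring.inverse (∏ u ∈ range (r i j - r i (j + 1)),
        (1 - (MvPowerSeries.X 0) ^ (u + 1)))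

lemma headFracHom_inverse_qFactorial (n : ℕ) :
    headFracHom 4 (Ring.inverse (∏ u ∈ range n, (1 - (MvPowerSeries.X 0) ^ (u + 1)))) =
      MvPowerSeries.C (qFactorial qElem n)⁻¹ := by
  rw [map_ring_inverse]
  · have h : headFracHom 4 (∏ u ∈ range n, (1 - (MvPowerSeries.X 0) ^ (u + 1))) =
        MvPowerSeries.C (qFactorial qElem n) := by
      rw [qFactorial, map_prod, map_prod]
      simp [headFracHom_X_zero]
    rw [h, ← map_ring_inverse _ (qFactorial_ne_zero one_sub_qElem_pow_ne_zero n).isUnit,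
      Ring.inverse_eq_inv']
  · refine IsUnit.prod_iff.2 fun u _ => isUnit_of_X_dvd_one_sub (s := 0) ?_
    rw [sub_sub_cancel]
    exact dvd_pow_self _ u.succ_ne_zero

lemma headFracHom_fermionicTerm {r : Fin 4 → ℕ → ℕ} (hr : ∀ i, IsDescending (r i)) :
    headFracHom 4 (fermionicTerm r) =
      MvPowerSeries.monomial (expOf fun i => ∑ᶠ t, r i t) (fermionicWeight qElem r) := by
  have h1 : ∀ i, headFracHom 4 (∏ᶠ j : ℕ, Ring.inverse (∏ u ∈ range (r i j - r i (j + 1)),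
      (1 - (MvPowerSeries.X 0) ^ (u + 1)))) = MvPowerSeries.C (stepWeight qElem (r i)) := fun i => by
    obtain ⟨_, N, hN⟩ := hr i
    rw [stepWeight, finprod_eq_prod_of_mulSupport_subset (s := range N),
      finprod_eq_prod_of_mulSupport_subset (s := range N), map_prod, map_prod]
    · exact prod_congr rfl fun j _ => headFracHom_inverse_qFactorial _
    all_goals
      intro t ht
      simp only [coe_range, Set.mem_Iio]
      by_contra h
      exact ht (by simp [hN t (by omega), qFactorial])
  have h2 : qElem ^ (exponentF4 r) = qElem ^ (exponentF4 r).toNat := by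
    rw [← zpow_natCast, Int.toNat_of_nonneg (exponentF4_nonneg hr)]
  rw [fermionicTerm, map_mul, map_mul, map_pow, map_prod, map_prod, headFracHom_X_zero,
    prod_congr rfl fun i _ => h1 i, fermionicWeight, h2]
  simp_rw [map_pow, headFracHom_X_succ]
  rw [MvPowerSeries.prod_X_pow_eq_monomial, MvPowerSeries.monomial_eq', MvPowerSeries.monomial_eq',
    map_mul, map_pow, map_prod, map_one]
  ring

lemma coeff_fermionicTerm_eq_zero {r : Fin 4 → ℕ → ℕ} (hr : ∀ i, IsDescending (r i))
    {γ : Fin 5 →₀ ℕ} (h : r ∉ Fintype.piFinset fun i => descSeq (γ.tail i)) :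
    MvPowerSeries.coeff γ (fermionicTerm r) = 0 := by
  have h1 := congrArg (MvPowerSeries.coeff γ.tail) (headFracHom_fermionicTerm hr)
  rw [MvPowerSeries.coeff_monomial, if_neg, coeff_headFracHom,
    map_eq_zero_iff _ (IsFractionRing.injective (PowerSeries ℤ) QField)] at h1
  · have h2 := congrArg (PowerSeries.coeff (γ 0)) h1
    rwa [coeff_mk, Finsupp.cons_tail, map_zero] at h2
  · intro h'
    refine h (Fintype.mem_piFinset.2 fun i => mem_descSeq.2 ⟨hr i, ?_⟩)
    rw [h']
    rfl

lemma headFracHom_tsum_fermionicTerm :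
    headFracHom 4 (∑' r : {r : Fin 4 → ℕ → ℕ // ∀ i, IsDescending (r i)}, fermionicTerm r.1) =
      fermionicSeries qElem := by
  classical
  have : T2Space (MvPowerSeries (Fin 5) ℤ) := inferInstanceAs (T2Space ((Fin 5 →₀ ℕ) → ℤ))
  have hdesc : ∀ β : Fin 4 → ℕ, ∀ r ∈ Fintype.piFinset fun i => descSeq (β i),
      ∀ i, IsDescending (r i) := fun β r hr i =>
    (mem_descSeq.1 (Fintype.mem_piFinset.1 hr i)).1
  let S : MvPowerSeries (Fin 5) ℤ := fun γ =>
    ∑ r ∈ Fintype.piFinset fun i => descSeq (γ.tail i), MvPowerSeries.coeff γ (fermionicTerm r)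
  have hS : HasSum (fun r : {r : Fin 4 → ℕ → ℕ // ∀ i, IsDescending (r i)} => fermionicTerm r.1)
      S := by
    refine (Pi.hasSum (X := fun _ : Fin 5 →₀ ℕ => ℤ)).2 fun γ => ?_
    have h := hasSum_sum_of_ne_finset_zero
      (f := fun r : {r : Fin 4 → ℕ → ℕ // ∀ i, IsDescending (r i)} =>
        MvPowerSeries.coeff γ (fermionicTerm r.1))
      (s := (Fintype.piFinset fun i => descSeq (γ.tail i)).subtype _)
      (L := SummationFilter.unconditional _)
      fun r hr => coeff_fermionicTerm_eq_zero r.2 (by simpa using hr)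
    rwa [sum_subtype_of_mem (fun r => MvPowerSeries.coeff γ (fermionicTerm r))
      (hdesc γ.tail)] at h
  rw [hS.tsum_eq]
  ext β
  have h1 : (PowerSeries.mk fun k => MvPowerSeries.coeff (β.cons k) S) =
      ∑ r ∈ Fintype.piFinset fun i => descSeq (β i),
        PowerSeries.mk fun k => MvPowerSeries.coeff (β.cons k) (fermionicTerm r) := by
    ext k
    simp only [coeff_mk, map_sum]
    change ∑ r ∈ Fintype.piFinset fun i => descSeq ((β.cons k).tail i), _ = _
    rw [Finsupp.tail_cons]
  rw [coeff_headFracHom, h1, map_sum, coeff_fermionicSeries]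
  refine sum_congr rfl fun r hr => ?_
  rw [← coeff_headFracHom, headFracHom_fermionicTerm (hdesc β r hr), MvPowerSeries.coeff_monomial,
    if_pos]
  ext i
  exact (mem_descSeq.1 (Fintype.mem_piFinset.1 hr i)).2.symm

lemma headFracHom_prod_tprod :
    headFracHom 4 (∏ c ∈ posRootsF4, ∏' n : ℕ, Ring.inverse
      (1 - (MvPowerSeries.X 0 : MvPowerSeries (Fin 5) ℤ) ^ (n + 1) *
        ∏ i : Fin 4, MvPowerSeries.X i.succ ^ c i)) = fermionicSeries qElem := by
  rw [prod_congr rfl fun c hc => tprod_inverse_one_sub (ne_zero_of_mem_posRootsF4 hc)]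
  set P := ∏ c ∈ posRootsF4, Ring.inverse (eulerMonomial c) with hP
  set Q := ∏ c ∈ posRootsF4, substMonomial c (eulerSeries qElem) with hQ
  have h1 : Q * headFracHom 4 P = 1 := by
    have : Q = headFracHom 4 (∏ c ∈ posRootsF4, eulerMonomial c) := by
      rw [map_prod]
      exact prod_congr rfl fun c hc =>
        (headFracHom_eulerMonomial (ne_zero_of_mem_posRootsF4 hc)).symm
    rw [this, ← map_mul, hP, ← prod_mul_distrib, prod_eq_one fun c hc =>
      Ring.mul_inverse_cancel _ (isUnit_eulerMonomial (ne_zero_of_mem_posRootsF4 hc)), map_one]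
  exact (left_inv_eq_right_inv (fermionicSeries_mul_prod qElem_ne_zero one_sub_qElem_pow_ne_zero)
    h1).symm

end Main
/-- The identity of Theorem 7.3 in type `F₄`.  In `ℤ[[q, y₁, y₂, y₃, y₄]]`
(variables indexed by `Fin 5`, `q = X 0`, `yᵢ = X i.succ`):
`∏_{c ∈ Φ⁺} ∏_{n ≥ 1} (1 - qⁿ y^c)⁻¹
  = ∑_{(r₁,…,r₄) descending} q^{E r} (∏ᵢ yᵢ^{|rᵢ|}) ∏ᵢ ∏_{j ≥ 1} (q;q)_{rᵢ^{(j)}-rᵢ^{(j+1)}}⁻¹`,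
with `E r = ∑_{i=1}^{4} ∑_{t≥1} (rᵢ^{(t)})² - ∑_{t≥1} r₁^{(t)} r₂^{(t)}
 - ∑_{t≥1} r₂^{(t)} (r₃^{(2t-1)} + r₃^{(2t)}) - ∑_{t≥1} r₃^{(t)} r₄^{(t)}`,
a nonnegative integer. -/
theorem stmt_12
    (E : (Fin 4 → ℕ → ℕ) → ℤ)
    (hE : ∀ r : Fin 4 → ℕ → ℕ, E r =
      (∑ i : Fin 4, ∑ᶠ t : ℕ, (r i t : ℤ) ^ 2)
        - (∑ᶠ t : ℕ, (r 0 t : ℤ) * (r 1 t : ℤ))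
        - (∑ᶠ t : ℕ, (r 1 t : ℤ) * ((r 2 (2 * t) : ℤ) + (r 2 (2 * t + 1) : ℤ)))
        - ∑ᶠ t : ℕ, (r 2 t : ℤ) * (r 3 t : ℤ)) :
    (∀ r : Fin 4 → ℕ → ℕ, (∀ i, IsDescending (r i)) → 0 ≤ E r)
    ∧ (∏ c ∈ posRootsF4, ∏' n : ℕ,
          Ring.inverse (1 - (X 0 : MvPowerSeries (Fin 5) ℤ) ^ (n + 1)
            * ∏ i : Fin 4, (X i.succ : MvPowerSeries (Fin 5) ℤ) ^ c i))
      = ∑' r : {r : Fin 4 → ℕ → ℕ // ∀ i, IsDescending (r i)},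
          (X 0 : MvPowerSeries (Fin 5) ℤ) ^ (E r.1).toNat
            * (∏ i : Fin 4, (X i.succ : MvPowerSeries (Fin 5) ℤ) ^ (∑ᶠ t : ℕ, r.1 i t))
            * ∏ i : Fin 4, ∏ᶠ j : ℕ,
                Ring.inverse (∏ u ∈ Finset.range (r.1 i j - r.1 i (j + 1)),
                  (1 - (X 0 : MvPowerSeries (Fin 5) ℤ) ^ (u + 1))) := by

  obtain rfl : E = exponentF4 := funext hE
  exact ⟨fun r hr => exponentF4_nonneg hr, headFracHom_injective
    (headFracHom_prod_tprod.trans headFracHom_tsum_fermionicTerm.symm)⟩
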